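/- With the star-shaped quiver data fixed, suppose H*_{σ,α} = {α}, i.e. σ^α = 1 and σ^δ ≠ 1 for every δ ∈ (ℕ^I)^* with 0 < δ ≤ α and δ ≠ α. Then (1/|GL_n(𝔽_q)|) · Σ_{h ∈ GL_n(𝔽_q)} Λ_m(h) · ∏_{i=1}^k R(γ_i)(h) equals the number of GL_α(𝔽_q)-orbits of representations x ∈ R(Q,α)(𝔽_q) such that x ⊗ 𝔽̄_q is indecomposable (i.e. the number of isomorphism classes of absolutely indecomposable representations of Q of dimension α over 𝔽_q). -/

import Mathlib

open Matrix

namespace QRep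

variable {I Ω : Type} (src tgt : Ω → I)

/-- A representation of the quiver with arrow set `Ω`, tail map `src`, head map `tgt`,
of dimension vector `β`, over the field `K`: a matrix of size `β (tgt a) × β (src a)`
for every arrow `a`. -/
def Rep (K : Type) [Field K] (β : I → ℕ) : Type :=
  ∀ a : Ω, Matrix (Fin (β (tgt a))) (Fin (β (src a))) K

/-- Isomorphism of representations (of possibly different dimension vectors). -/
def RepIso {K : Type} [Field K] {β γ : I → ℕ} (x : Rep src tgt K β) (y : Rep src tgt K γ) :
    Prop :=
  ∃ e : ∀ i, (Fin (β i) → K) ≃ₗ[K] (Fin (γ i) → K),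
    ∀ a : Ω, (Matrix.mulVecLin (y a)).comp (e (src a) : (Fin (β (src a)) → K) →ₗ[K] _)
      = ((e (tgt a) : (Fin (β (tgt a)) → K) →ₗ[K] _)).comp (Matrix.mulVecLin (x a))

/-- Direct sum (block diagonal) of two representations. -/
def dsum {K : Type} [Field K] {β γ : I → ℕ} (x : Rep src tgt K β) (y : Rep src tgt K γ) :
    Rep src tgt K (β + γ) :=
  fun a => Matrix.reindex finSumFinEquiv finSumFinEquiv (Matrix.fromBlocks (x a) 0 0 (y a))

/-- A representation is indecomposable if its dimension vector is nonzero and it is not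
isomorphic to a direct sum of two representations of nonzero dimension vectors. -/
def Indec {K : Type} [Field K] {β : I → ℕ} (x : Rep src tgt K β) : Prop :=
  β ≠ 0 ∧ ∀ (β₁ β₂ : I → ℕ) (y : Rep src tgt K β₁) (z : Rep src tgt K β₂),
    β₁ ≠ 0 → β₂ ≠ 0 → ¬ RepIso src tgt x (dsum src tgt y z)

/-- Base change of a representation along a ring homomorphism of fields. -/
def baseChange {K L : Type} [Field K] [Field L] (f : K →+* L) {β : I → ℕ}
    (x : Rep src tgt K β) : Rep src tgt L β :=
  fun a => (x a).map f

/-- `x` is of level at most `V`: every indecomposable direct summand of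
`x ⊗ K̄` has dimension vector belonging to `V`. -/
def LevelAtMost {K : Type} [Field K] {β : I → ℕ} (x : Rep src tgt K β)
    (V : Set (I → ℕ)) : Prop :=
  ∀ (γ δ : I → ℕ) (Y : Rep src tgt (AlgebraicClosure K) γ)
    (z : Rep src tgt (AlgebraicClosure K) δ), Indec src tgt Y →
    RepIso src tgt (baseChange src tgt (algebraMap K (AlgebraicClosure K)) x)
      (dsum src tgt Y z) → γ ∈ V

/-- The action of `GL_β(K)` on representations of dimension vector `β`. -/
def glAct {K : Type} [Field K] {β : I → ℕ} (g : ∀ i, GL (Fin (β i)) K)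
    (x : Rep src tgt K β) : Rep src tgt K β :=
  fun a => ((g (tgt a) : Matrix (Fin (β (tgt a))) (Fin (β (tgt a))) K) * x a) *
    (((g (src a))⁻¹ : GL (Fin (β (src a))) K) : Matrix (Fin (β (src a))) (Fin (β (src a))) K)

/-- The number of `GL_β(K)`-orbits of representations of dimension vector `β`
satisfying the property `P`. -/
noncomputable def orbitCount {K : Type} [Field K] (β : I → ℕ)
    (P : Rep src tgt K β → Prop) : ℕ :=
  Nat.card (Quot fun x y : {x : Rep src tgt K β // P x} =>
    ∃ g : ∀ i, GL (Fin (β i)) K, glAct src tgt g x.1 = y.1)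


open scoped Classical

/-- Apply a character `χ : 𝔽_q^× → ℂ^×` to a field element (0 outside the units). -/
noncomputable def χap {F : Type} [Field F] (χ : Fˣ →* ℂˣ) (d : F) : ℂ :=
  if h : d = 0 then 0 else χ (Units.mk0 d h)

/-- The determinant of the endomorphism induced by `T` on the subquotient `W / (U ∩ W)`
(defined to be `0` if `T` does not preserve `W` and `U`). -/
noncomputable def quotDet {F M : Type} [Field F] [AddCommGroup M] [Module F M]
    (T : M →ₗ[F] M) (W U : Submodule F M) : F :=
  if h : (∀ x ∈ W, T x ∈ W) ∧ (∀ x ∈ U, T x ∈ U) then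
    LinearMap.det (Submodule.mapQ (U.comap W.subtype) (U.comap W.subtype) (T.restrict h.1)
      (fun x hx => by
        simpa only [Submodule.mem_comap, LinearMap.restrict_apply, Submodule.subtype_apply]
          using h.2 x.1 hx))
  else 0

/-- The Harish-Chandra induced character of the linear character `γ` of the Levi
`GL_{n_0} × ⋯ × GL_{n_l}` of `GL_n(𝔽_q)`, evaluated at `g`: the sum over all `g`-stable
flags `𝔽_q^n = V_0 ⊇ V_1 ⊇ ⋯` with `dim V_j = β j`, of `∏_{j=0}^{l} γ_j(det(ḡ_j))`,
where `ḡ_j` is the automorphism induced by `g` on `V_j / V_{j+1}`. -/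
noncomputable def HC (F : Type) [Field F] (n l : ℕ) (β : ℕ → ℕ) (γ : ℕ → (Fˣ →* ℂˣ))
    (g : GL (Fin n) F) : ℂ :=
  ∑ᶠ V : {V : ℕ → Submodule F (Fin n → F) //
      V 0 = ⊤ ∧ (∀ j, V (j + 1) ≤ V j) ∧ (∀ j, Module.finrank F (V j) = β j) ∧
      (∀ j, ∀ v ∈ V j, Matrix.mulVecLin (g : Matrix (Fin n) (Fin n) F) v ∈ V j)},
    ∏ j ∈ Finset.range (l + 1),
      χap (γ j) (quotDet (Matrix.mulVecLin (g : Matrix (Fin n) (Fin n) F))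
        (V.1 j) (V.1 (j + 1)))

/-- The number of `m`-tuples of `n × n` matrices commuting with `g`; i.e. the character
of the conjugation action of `GL_n(𝔽_q)` on `𝔤𝔩_n(𝔽_q)^m`. -/
noncomputable def Λcount (F : Type) [Field F] (n m : ℕ) (g : GL (Fin n) F) : ℕ :=
  Nat.card {A : Fin m → Matrix (Fin n) (Fin n) F //
    ∀ r, (g : Matrix (Fin n) (Fin n) F) * A r = A r * (g : Matrix (Fin n) (Fin n) F)}


/-- Vertices of the star-shaped quiver: `none` is the central vertex `0`, and
`some ⟨i, j⟩` is the vertex `[i, j+1]` on leg `i` (so `j : Fin (s i)` runs through the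
leg vertices `[i,1], …, [i, s_i]`). -/
abbrev StarV (k : ℕ) (s : Fin k → ℕ) := Option ((i : Fin k) × Fin (s i))

/-- Arrows of the star-shaped quiver: `m` loops at the central vertex together with, for
each leg `i` and each `j`, one arrow `[i, j+1] → [i, j]`. -/
abbrev StarA (k m : ℕ) (s : Fin k → ℕ) := Fin m ⊕ ((i : Fin k) × Fin (s i))

/-- The vertex `[i, j]` preceding `[i, j+1]` on a leg (the central vertex if `j = 0`). -/
def legPrev (k : ℕ) (s : Fin k → ℕ) (a : (i : Fin k) × Fin (s i)) : StarV k s :=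
  if h : a.2.1 = 0 then none
  else some ⟨a.1, ⟨a.2.1 - 1, lt_of_le_of_lt (Nat.pred_le _) a.2.2⟩⟩

/-- Tail map of the star-shaped quiver. -/
def starSrc (k m : ℕ) (s : Fin k → ℕ) : StarA k m s → StarV k s
  | .inl _ => none
  | .inr a => some a

/-- Head map of the star-shaped quiver. -/
def starTgt (k m : ℕ) (s : Fin k → ℕ) : StarA k m s → StarV k s
  | .inl _ => none
  | .inr a => legPrev k s a

/-- A dimension vector is non-increasing along each leg. -/
def NonIncr (k : ℕ) (s : Fin k → ℕ) (δ : StarV k s → ℕ) : Prop :=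
  ∀ a : (i : Fin k) × Fin (s i), δ (some a) ≤ δ (legPrev k s a)

/-- `legβ k s nn i j = n_{i,j} + n_{i,j+1} + ⋯ + n_{i,s_i}`. -/
def legβ (k : ℕ) (s : Fin k → ℕ) (nn : Fin k → ℕ → ℕ) (i : Fin k) (j : ℕ) : ℕ :=
  ∑ h ∈ Finset.Icc j (s i), nn i h

/-- The dimension vector `α`: `α_0 = n`, `α_{[i,j]} = n_{i,j} + ⋯ + n_{i,s_i}`. -/
def starα (k n : ℕ) (s : Fin k → ℕ) (nn : Fin k → ℕ → ℕ) : StarV k s → ℕ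
  | none => n
  | some a => legβ k s nn a.1 (a.2.1 + 1)

/-- The tuple `σ`: `σ_0 = ∏_i γ_{i,0}` and `σ_{[i,j]} = γ_{i,j} γ_{i,j-1}^{-1}`. -/
noncomputable def starσ (F : Type) [Field F] (k : ℕ) (s : Fin k → ℕ)
    (γ : Fin k → ℕ → (Fˣ →* ℂˣ)) : StarV k s → (Fˣ →* ℂˣ)
  | none => ∏ i, γ i 0
  | some a => γ a.1 (a.2.1 + 1) * (γ a.1 a.2.1)⁻¹


/-- The multiplicity `⟨Λ ⊗ R(γ_1) ⊗ ⋯ ⊗ R(γ_k), 1⟩ =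
(1/|GL_n(𝔽_q)|) Σ_h Λ_m(h) ∏_i R(γ_i)(h)`. -/
noncomputable def mult (F : Type) [Field F] [Fintype F] (k m n : ℕ) (s : Fin k → ℕ)
    (nn : Fin k → ℕ → ℕ) (γ : Fin k → ℕ → (Fˣ →* ℂˣ)) : ℂ :=
  (Nat.card (GL (Fin n) F) : ℂ)⁻¹ *
    ∑ᶠ h : GL (Fin n) F,
      (Λcount F n m h : ℂ) * ∏ i : Fin k, HC F n (s i) (legβ k s nn i) (γ i) h

end QRep

namespace QRep

/-- If a finite field extension `K` of `F` acts `F`-linearly on `W`, the determinant of the action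
of `c : K` is a power of its norm. -/
lemma exists_det_eq_norm_pow {F K W : Type} [Field F] [Field K] [Algebra F K]
    [FiniteDimensional F K] [AddCommGroup W] [Module F W]
    (ρ : K →ₐ[F] Module.End F W) :
    ∃ r, Module.finrank F W = Module.finrank F K * r ∧
      ∀ c, LinearMap.det (ρ c) = (Algebra.norm F c) ^ r := by
  let _ : Module K W := Module.compHom W ρ.toRingHom
  have hsm : ∀ (c : K) (w : W), c • w = ρ c w := fun _ _ => rfl
  have : IsScalarTower F K W := ⟨fun a c w => by simp [hsm]⟩
  refine ⟨Module.finrank K W, (Module.finrank_mul_finrank F K W).symm, fun c => ?_⟩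
  have h : ρ c = (c • (LinearMap.id : W →ₗ[K] W)).restrictScalars F := by
    ext w; simp [hsm]
  rw [h, LinearMap.det_restrictScalars, LinearMap.det_smul]
  simp

/-- The elements of a finite-dimensional algebra over a finite field have a Frobenius power
that is killed by a squarefree polynomial. -/
lemma exists_pow_card_minpoly_squarefree (F : Type) [Field F] [Fintype F] {A : Type} [Ring A]
    [Algebra F A] [Finite A] (t : A) :
    ∃ N : ℕ, Squarefree (minpoly F (t ^ Fintype.card F ^ N)) := by
  obtain ⟨a, b, hab, h⟩ := Finite.exists_ne_map_eq_of_infinite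
    (fun N : ℕ => t ^ Fintype.card F ^ N)
  wlog hlt : a < b generalizing a b
  · exact this b a hab.symm h.symm (by omega)
  refine ⟨a, ?_⟩
  obtain ⟨p, hp⟩ := CharP.exists F
  have hdvd : p ∣ Fintype.card F ^ (b - a) := by
    refine dvd_pow ?_ (by omega)
    rw [← CharP.cast_eq_zero_iff F p, FiniteField.cast_card_eq_zero]
  refine ((galois_poly_separable (K := F) p _ hdvd).squarefree).squarefree_of_dvd
    (minpoly.dvd F _ ?_)
  simp only [map_sub, map_pow, Polynomial.aeval_X]
  rw [← pow_mul, ← pow_add, Nat.add_sub_cancel' hlt.le, sub_eq_zero]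
  exact h.symm

lemma isNilpotent_sub_of_pow_card_eq {F : Type} [Field F] [Fintype F] {A : Type} [Ring A]
    [Nontrivial A] [Algebra F A] {t : A} {N : ℕ} {a : F}
    (h : t ^ Fintype.card F ^ N = algebraMap F A a) :
    IsNilpotent (t - algebraMap F A a) := by
  obtain ⟨p, hp⟩ := CharP.exists F
  obtain ⟨r, hpp, hr⟩ := FiniteField.card F p
  have : Fact p.Prime := ⟨hpp⟩
  have : CharP A p := charP_of_injective_algebraMap (algebraMap F A).injective p
  refine ⟨Fintype.card F ^ N, ?_⟩
  have hq : Fintype.card F ^ N = p ^ ((r : ℕ) * N) := by rw [hr, pow_mul]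
  rw [hq, sub_pow_char_pow_of_commute p _ (Algebra.commutes a t).symm, ← hq, h, ← map_pow,
    FiniteField.pow_card_pow, sub_self]

/-- Every nilpotent element lies in a nilpotent ideal if every element is scalar plus nilpotent. -/
lemma exists_prod_eq_zero_of_scalar_add_nilpotent {F A : Type} [Field F] [Ring A] [Algebra F A]
    [FiniteDimensional F A]
    (H : ∀ t : A, ∃ a : F, IsNilpotent (t - algebraMap F A a)) :
    ∃ k : ℕ, ∀ s : Fin k → A, (∀ i, IsNilpotent (s i)) → (List.ofFn s).prod = 0 := by
  have : IsArtinianRing A := IsArtinianRing.of_finite F A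
  have hdich : ∀ t : A, IsNilpotent t ∨ IsUnit t := by
    intro t
    obtain ⟨a, ha⟩ := H t
    by_cases h0 : a = 0
    · left; simpa [h0] using ha
    · right
      have hu : IsUnit (algebraMap F A a) := (IsUnit.mk0 a h0).map _
      have := ha.isUnit_add_left_of_commute hu (Algebra.commutes a _).symm
      simpa using this
  have hmem : ∀ t : A, IsNilpotent t → t ∈ Ring.jacobson A := by
    intro t ht
    rw [← Ideal.jacobson_bot, Ideal.mem_jacobson_iff]
    intro y
    have hyt : IsNilpotent (y * t) := by
      rcases hdich (y * t) with h | h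
      · exact h
      · obtain ⟨n, hn⟩ := ht
        obtain ⟨u, hu⟩ := h
        have hz : ∀ j, t ^ j = 0 → (1 : A) = 0 := by
          intro j
          induction j with
          | zero => intro h; simpa using h
          | succ j ih =>
            intro h
            apply ih
            have : (↑u⁻¹ : A) * y * t ^ (j + 1) = t ^ j := by
              rw [pow_succ', ← mul_assoc, mul_assoc _ y t, ← hu]; simp
            rw [← this, h, mul_zero]
        have h10 := hz n hn
        exact ⟨1, by rw [pow_one, ← one_mul (y * t), h10, zero_mul]⟩
    have hu := hyt.isUnit_one_add
    obtain ⟨u, hu⟩ := hu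
    refine ⟨(↑u⁻¹ : A), ?_⟩
    rw [Ideal.mem_bot, sub_eq_zero]
    have : (↑u⁻¹ : A) * y * t + ↑u⁻¹ = ↑u⁻¹ * (1 + y * t) := by
      rw [mul_add, mul_one, mul_assoc, add_comm]
    rw [this, ← hu]; simp
  obtain ⟨k, hk⟩ := IsSemiprimaryRing.isNilpotent (R := A)
  refine ⟨k, fun s hs => ?_⟩
  have : ∀ (k : ℕ) (s : Fin k → A), (∀ i, IsNilpotent (s i)) →
      (List.ofFn s).prod ∈ (Ring.jacobson A) ^ k := by
    intro k
    induction k with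
    | zero => intro s _; rw [Submodule.pow_zero, Ideal.one_eq_top]; trivial
    | succ k ih =>
      intro s hs
      rw [List.ofFn_succ, List.prod_cons, Ideal.IsTwoSided.pow_succ]
      exact Ideal.mul_mem_mul (hmem _ (hs 0)) (ih _ fun i => hs i.succ)
  have h := this k s hs
  rw [hk] at h
  simpa using h

/-- In an algebra over an algebraically closed field, an element with squarefree minimal
polynomial is scalar if the polynomials in it contain no nontrivial idempotent. -/
lemma eq_algebraMap_of_idempotents {L A : Type} [Field L] [IsAlgClosed L] [Ring A] [Nontrivial A]
    [Algebra L A] [FiniteDimensional L A] (t : A) {f : Polynomial L} (hf : Squarefree f)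
    (hft : Polynomial.aeval t f = 0)
    (hid : ∀ e ∈ Algebra.adjoin L {t}, e * e = e → e = 0 ∨ e = 1) :
    ∃ c : L, t = algebraMap L A c := by
  have h_integral : IsIntegral L t := Algebra.IsIntegral.isIntegral t
  have hsq : Squarefree (minpoly L t) := hf.squarefree_of_dvd (minpoly.dvd L t hft)
  obtain ⟨c, hc⟩ := IsAlgClosed.exists_root (minpoly L t) (minpoly.degree_pos h_integral).ne'
  obtain ⟨g, hg⟩ := Polynomial.dvd_iff_isRoot.mpr hc
  have hcop : IsCoprime (Polynomial.X - Polynomial.C c) g := by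
    rw [(Polynomial.irreducible_X_sub_C c).coprime_iff_not_dvd]
    rintro ⟨g', hg'⟩
    have := hsq (Polynomial.X - Polynomial.C c) ⟨g', by rw [hg, hg']; ring⟩
    exact (Polynomial.irreducible_X_sub_C c).not_isUnit this
  obtain ⟨a, b, hab⟩ := hcop
  set e := Polynomial.aeval t (b * g) with he
  have hzero : Polynomial.aeval t ((Polynomial.X - Polynomial.C c) * g) = 0 := by
    rw [← hg, minpoly.aeval]
  have hee : e * e = e := by
    have : b * g * (b * g) = b * g - a * b * ((Polynomial.X - Polynomial.C c) * g) := by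
      linear_combination (b * g) * hab
    rw [he, ← map_mul, this, map_sub, map_mul _ (a * b), hzero, mul_zero, sub_zero]
  rcases hid e (by rw [he]; exact Polynomial.aeval_mem_adjoin_singleton _ _) hee with h | h
  · exfalso
    have hd := minpoly.dvd L t h
    rw [hg] at hd
    have h1 : (Polynomial.X - Polynomial.C c) ∣ b * g := (dvd_mul_right _ _).trans hd
    have h2 : (Polynomial.X - Polynomial.C c) ∣ 1 := by
      rw [← hab]; exact dvd_add (dvd_mul_left _ _) h1
    exact (Polynomial.irreducible_X_sub_C c).not_isUnit (isUnit_of_dvd_one h2)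
  · refine ⟨c, ?_⟩
    have : Polynomial.aeval t ((Polynomial.X - Polynomial.C c) * (b * g)) = 0 := by
      rw [show (Polynomial.X - Polynomial.C c) * (b * g)
        = b * ((Polynomial.X - Polynomial.C c) * g) by ring, map_mul, hzero, mul_zero]
    rw [map_mul, ← he, h, mul_one] at this
    simpa [sub_eq_zero] using this

end QRep

namespace QRep

variable {I Ω : Type} {src tgt : Ω → I}

/-- The endomorphism algebra of a representation. -/
def endAlg {K : Type} [Field K] {β : I → ℕ} (x : Rep src tgt K β) :
    Subalgebra K (∀ v, Matrix (Fin (β v)) (Fin (β v)) K) where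
  carrier := {t | ∀ a, t (tgt a) * x a = x a * t (src a)}
  mul_mem' := by
    intro s t hs ht a
    simp only [Set.mem_ofPred_eq] at hs ht
    rw [Pi.mul_apply, Pi.mul_apply, Matrix.mul_assoc, ht, ← Matrix.mul_assoc, hs, Matrix.mul_assoc]
  add_mem' := by
    intro s t hs ht a
    simp only [Set.mem_ofPred_eq] at hs ht
    rw [Pi.add_apply, Pi.add_apply, Matrix.add_mul, Matrix.mul_add, hs, ht]
  algebraMap_mem' := by
    intro c a
    rw [Algebra.algebraMap_eq_smul_one]
    simp

/-- Entrywise base change of a family of square matrices. -/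
def piMap {K L : Type} [Field K] [Field L] (f : K →+* L) (β : I → ℕ) :
    (∀ v, Matrix (Fin (β v)) (Fin (β v)) K) →+* (∀ v, Matrix (Fin (β v)) (Fin (β v)) L) :=
  RingHom.pi fun v => f.mapMatrix.comp (Pi.evalRingHom _ v)

lemma piMap_apply {K L : Type} [Field K] [Field L] (f : K →+* L) {β : I → ℕ}
    (t : ∀ v, Matrix (Fin (β v)) (Fin (β v)) K) (v : I) : piMap f β t v = (t v).map f := rfl

lemma piMap_injective {K L : Type} [Field K] [Field L] (f : K →+* L) (β : I → ℕ) :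
    Function.Injective (piMap f β) := by
  intro s t h
  funext v
  ext i j
  have := congrFun (congrFun (congrFun h v) i) j
  exact f.injective this

lemma piMap_mem_endAlg {K L : Type} [Field K] [Field L] (f : K →+* L) {β : I → ℕ}
    {x : Rep src tgt K β} {t : ∀ v, Matrix (Fin (β v)) (Fin (β v)) K} (ht : t ∈ endAlg x) :
    piMap f β t ∈ endAlg (baseChange src tgt f x) := by
  intro a
  simp only [piMap_apply, baseChange]
  rw [← Matrix.map_mul, ht a, Matrix.map_mul]

/-- Every endomorphism of the base change is a linear combination of endomorphisms defined over
the ground field. -/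
lemma exists_eq_sum_piMap [Fintype I] {F L : Type} [Field F] [Field L] [Algebra F L] {β : I → ℕ}
    (x : Rep src tgt F β) {e : ∀ v, Matrix (Fin (β v)) (Fin (β v)) L}
    (he : e ∈ endAlg (baseChange src tgt (algebraMap F L) x)) :
    ∃ (S : Finset L) (t : L → ∀ v, Matrix (Fin (β v)) (Fin (β v)) F),
      (∀ b, t b ∈ endAlg x) ∧ e = ∑ b ∈ S, b • piMap (algebraMap F L) β (t b) := by
  classical
  let B := Module.Basis.ofVectorSpace F L
  let t : (Module.Basis.ofVectorSpaceIndex F L) → ∀ v, Matrix (Fin (β v)) (Fin (β v)) F :=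
    fun b v => (e v).map fun y => B.repr y b
  have hB : ∀ (y : L) (r : F) b, B.repr (y * algebraMap F L r) b = B.repr y b * r := by
    intro y r b
    rw [mul_comm, ← Algebra.smul_def, map_smul, Finsupp.smul_apply, smul_eq_mul, mul_comm]
  have ht : ∀ b, t b ∈ endAlg x := by
    intro b a
    have h := he a
    ext i j
    have h1 := congrFun (congrFun h i) j
    simp only [baseChange, Matrix.mul_apply, Matrix.map_apply] at h1
    simp only [Matrix.mul_apply, t, Matrix.map_apply]
    have h2 := congrArg (fun y => B.repr y b) h1
    simp only [map_sum, Finsupp.finsetSum_apply] at h2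
    convert h2 using 2 with l _ l _
    · exact (hB _ _ _).symm
    · rw [mul_comm (algebraMap F L _), mul_comm]
      exact (hB _ _ _).symm
  let S : Finset (Module.Basis.ofVectorSpaceIndex F L) :=
    Finset.univ.biUnion fun v : I => Finset.univ.biUnion fun i : Fin (β v) =>
      Finset.univ.biUnion fun j : Fin (β v) => (B.repr (e v i j)).support
  refine ⟨S.image (↑), fun b => if h : b ∈ Module.Basis.ofVectorSpaceIndex F L then t ⟨b, h⟩ else 0,
    fun b => ?_, ?_⟩
  · dsimp only
    split_ifs with h
    · exact ht _
    · exact (endAlg x).zero_mem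
  · rw [Finset.sum_image (by intro a _ b _ h; exact Subtype.ext h)]
    funext v
    ext i j
    rw [Finset.sum_apply, Matrix.sum_apply]
    conv_lhs => rw [← B.linearCombination_repr (e v i j)]
    rw [Finsupp.linearCombination_apply, Finsupp.sum_of_support_subset (s := S)]
    · refine Finset.sum_congr rfl fun b _ => ?_
      have hb : (b : L) ∈ Module.Basis.ofVectorSpaceIndex F L := b.2
      simp only [hb, dif_pos, Pi.smul_apply, Matrix.smul_apply, piMap_apply, Matrix.map_apply, t]
      rw [Algebra.smul_def, smul_eq_mul, mul_comm]
      congr 1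
      exact Module.Basis.ofVectorSpace_apply_self F L b
    · intro b hb
      simp only [S, Finset.mem_biUnion]
      exact ⟨v, Finset.mem_univ _, i, Finset.mem_univ _, j, Finset.mem_univ _, hb⟩
    · simp

/-- If every endomorphism over `F` is scalar plus nilpotent, then no base change of the
representation has nontrivial idempotent endomorphisms. -/
lemma idempotent_baseChange_of_scalar_add_nilpotent [Fintype I] {F L : Type} [Field F] [Field L]
    [Algebra F L] {β : I → ℕ} (x : Rep src tgt F β)
    (H : ∀ t ∈ endAlg x, ∃ a : F, IsNilpotent (t - algebraMap F _ a))
    (e : ∀ v, Matrix (Fin (β v)) (Fin (β v)) L)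
    (he : e ∈ endAlg (baseChange src tgt (algebraMap F L) x)) (hee : e * e = e) :
    e = 0 ∨ e = 1 := by
  classical
  have H' : ∀ t : endAlg x, ∃ a : F, IsNilpotent (t - algebraMap F (endAlg x) a) := by
    intro t
    obtain ⟨a, n, hn⟩ := H t t.2
    exact ⟨a, n, Subtype.ext hn⟩
  obtain ⟨k, hk⟩ := exists_prod_eq_zero_of_scalar_add_nilpotent H'
  obtain ⟨S, t, ht, hsum⟩ := exists_eq_sum_piMap x he
  choose a ha using fun b => H' ⟨t b, ht b⟩
  set ι := piMap (algebraMap F L) β with hι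
  let ν : L → endAlg x := fun b => ⟨t b, ht b⟩ - algebraMap F (endAlg x) (a b)
  set n : ∀ v, Matrix (Fin (β v)) (Fin (β v)) L := ∑ b ∈ S, b • ι (ν b) with hn
  set c : L := ∑ b ∈ S, b * algebraMap F L (a b) with hc
  have hιa : ∀ y : F, ι (algebraMap F _ y) = algebraMap L _ (algebraMap F L y) := by
    intro y
    funext v
    ext i j
    simp [hι, piMap_apply, Matrix.algebraMap_matrix_apply, apply_ite (algebraMap F L)]
  have hdec : e = algebraMap L _ c + n := by
    rw [hsum, hn, hc, map_sum, ← Finset.sum_add_distrib]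
    refine Finset.sum_congr rfl fun b _ => ?_
    have : ι (ν b) = ι (t b) - algebraMap L _ (algebraMap F L (a b)) := by
      rw [← hιa, ← map_sub]; rfl
    rw [this, smul_sub, map_mul, Algebra.smul_def b (algebraMap L _ _)]
    abel
  let T : ℕ → Set (∀ v, Matrix (Fin (β v)) (Fin (β v)) L) := fun j =>
    {y | ∃ s : Fin j → endAlg x, (∀ i, IsNilpotent (s i)) ∧ y = ι ((List.ofFn s).prod : endAlg x)}
  have hnT : ∀ j, n ^ j ∈ Submodule.span L (T j) := by
    intro j
    induction j with
    | zero =>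
      refine Submodule.subset_span ⟨Fin.elim0, fun i => i.elim0, ?_⟩
      simp
    | succ j ih =>
      have h1 : n ∈ Submodule.span L {y | ∃ s : endAlg x, IsNilpotent s ∧ y = ι s} :=
        Submodule.sum_mem _ fun b _ => Submodule.smul_mem _ _
          (Submodule.subset_span ⟨ν b, ha b, rfl⟩)
      have h2 := Submodule.mul_mem_mul h1 ih
      rw [Submodule.span_mul_span, ← pow_succ'] at h2
      refine Submodule.span_mono ?_ h2
      rintro _ ⟨_, ⟨s, hs, rfl⟩, _, ⟨s', hs', rfl⟩, rfl⟩
      refine ⟨Fin.cons s s', ?_, ?_⟩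
      · intro i
        refine Fin.cases hs hs' i
      · simp [List.ofFn_succ]
  have hnil : IsNilpotent n := by
    refine ⟨k, ?_⟩
    have h1 := hnT k
    have h2 : T k ⊆ {0} := by
      rintro _ ⟨s, hs, rfl⟩
      rw [hk s hs]; simp
    have h3 := Submodule.span_mono (R := L) h2 h1
    simpa using h3
  by_cases hc0 : c = 0
  · left
    rw [hdec, hc0, map_zero, zero_add] at hee
    have hpow : ∀ j, n ^ (j + 1) = n := by
      intro j
      induction j with
      | zero => simp
      | succ j ih => rw [pow_succ, ih, hee]
    obtain ⟨j, hj⟩ := hnil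
    have h0 : n = 0 := by
      rw [← hpow j, pow_succ, hj, zero_mul]
    rw [hdec, hc0, h0]; simp
  · right
    have hu : IsUnit e := by
      rw [hdec, add_comm]
      refine (hnil.isUnit_add_left_of_commute ((IsUnit.mk0 c hc0).map (algebraMap L _))
        (Algebra.commutes c n).symm)
        |> fun h => ?_
      rwa [add_comm] at h
    exact hu.mul_left_cancel (by rw [hee, mul_one])

/-- If the base change to an algebraically closed field has only trivial idempotents, then every
endomorphism over the finite ground field is scalar plus nilpotent. -/
lemma scalar_add_nilpotent_of_idempotent_baseChange [Fintype I] {F L : Type} [Field F] [Fintype F]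
    [Field L] [IsAlgClosed L] [Algebra F L] {β : I → ℕ} (v₀ : I) (hβ : β v₀ ≠ 0)
    (x : Rep src tgt F β)
    (H : ∀ e ∈ endAlg (baseChange src tgt (algebraMap F L) x), e * e = e → e = 0 ∨ e = 1)
    (t : ∀ v, Matrix (Fin (β v)) (Fin (β v)) F) (ht : t ∈ endAlg x) :
    ∃ a : F, IsNilpotent (t - algebraMap F _ a) := by
  classical
  have : Nonempty (Fin (β v₀)) := ⟨⟨0, Nat.pos_of_ne_zero hβ⟩⟩
  have : Nontrivial (∀ v, Matrix (Fin (β v)) (Fin (β v)) F) :=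
    Pi.nontrivial_at v₀
  have : Nontrivial (∀ v, Matrix (Fin (β v)) (Fin (β v)) L) :=
    Pi.nontrivial_at v₀
  obtain ⟨N, hN⟩ := exists_pow_card_minpoly_squarefree F t
  set t' := t ^ Fintype.card F ^ N with ht'
  have hsep : ((minpoly F t').map (algebraMap F L)).Separable :=
    (PerfectField.separable_iff_squarefree.mpr hN).map
  let ι : (∀ v, Matrix (Fin (β v)) (Fin (β v)) F) →ₐ[F] (∀ v, Matrix (Fin (β v)) (Fin (β v)) L) :=
    { piMap (algebraMap F L) β with
      commutes' := by
        intro y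
        funext v
        ext i j
        simp [piMap_apply, Matrix.algebraMap_matrix_apply, apply_ite (algebraMap F L)] }
  have hzero : Polynomial.aeval (ι t') ((minpoly F t').map (algebraMap F L)) = 0 := by
    rw [Polynomial.aeval_map_algebraMap, Polynomial.aeval_algHom_apply, minpoly.aeval, map_zero]
  obtain ⟨c, hc⟩ := eq_algebraMap_of_idempotents (ι t') hsep.squarefree hzero (by
    intro e he
    refine H e ?_
    refine (Algebra.adjoin_le ?_ : Algebra.adjoin L {ι t'} ≤ _) he
    rw [Set.singleton_subset_iff]
    exact piMap_mem_endAlg _ (pow_mem ht _))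
  let i₀ : Fin (β v₀) := ⟨0, Nat.pos_of_ne_zero hβ⟩
  refine ⟨t' v₀ i₀ i₀, isNilpotent_sub_of_pow_card_eq (N := N) ?_⟩
  rw [← ht']
  have h0 : algebraMap F L (t' v₀ i₀ i₀) = c := by
    have := congrFun (congrFun (congrFun hc v₀) i₀) i₀
    simp only [Pi.algebraMap_apply, Matrix.algebraMap_matrix_apply, if_true, Algebra.algebraMap_self,
      RingHom.id_apply] at this
    exact this
  apply piMap_injective (algebraMap F L) β
  change ι t' = ι _
  rw [hc, AlgHom.commutes, ← h0]
  rfl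

end QRep

namespace QRep

/-- Concatenation of coordinate vectors as a linear equivalence. -/
noncomputable def glue (K : Type) [Field K] (m n : ℕ) :
    ((Fin m → K) × (Fin n → K)) ≃ₗ[K] (Fin (m + n) → K) :=
  (LinearEquiv.sumArrowLequivProdArrow (Fin m) (Fin n) K K).symm ≪≫ₗ
    LinearEquiv.funCongrLeft K K finSumFinEquiv.symm

lemma reindex_fromBlocks_mulVec_glue {K : Type} [Field K] {m n m' n' : ℕ}
    (A : Matrix (Fin m') (Fin m) K) (D : Matrix (Fin n') (Fin n) K)
    (p : (Fin m → K) × (Fin n → K)) :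
    (Matrix.reindex finSumFinEquiv finSumFinEquiv (Matrix.fromBlocks A 0 0 D)) *ᵥ glue K m n p
      = glue K m' n' (A *ᵥ p.1, D *ᵥ p.2) := by
  have h : ∀ (m n : ℕ) (p : (Fin m → K) × (Fin n → K)),
      glue K m n p = Sum.elim p.1 p.2 ∘ finSumFinEquiv.symm := fun _ _ _ => rfl
  rw [h, h, Matrix.reindex_apply, Matrix.submatrix_mulVec_equiv]
  congr 1
  rw [Function.comp_assoc, Equiv.symm_symm]
  have : (finSumFinEquiv.symm ∘ finSumFinEquiv : Fin m ⊕ Fin n → _) = id := by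
    funext y; simp
  rw [this, Function.comp_id, Matrix.fromBlocks_mulVec]
  simp

variable {I Ω : Type} {src tgt : Ω → I}

/-- Idempotent endomorphisms of an indecomposable representation are trivial. -/
lemma Indec.idempotent {K : Type} [Field K] {β : I → ℕ} {x : Rep src tgt K β}
    (hx : Indec src tgt x) (e : ∀ v, Matrix (Fin (β v)) (Fin (β v)) K) (he : e ∈ endAlg x)
    (hee : e * e = e) : e = 0 ∨ e = 1 := by
  by_contra hne
  push Not at hne
  have hee' : ∀ v w, e v *ᵥ (e v *ᵥ w) = e v *ᵥ w := by
    intro v w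
    rw [Matrix.mulVec_mulVec]
    exact congrArg (· *ᵥ w) (congrFun hee v)
  have hcomm : ∀ a w, e (tgt a) *ᵥ (x a *ᵥ w) = x a *ᵥ (e (src a) *ᵥ w) := by
    intro a w
    rw [Matrix.mulVec_mulVec, Matrix.mulVec_mulVec, he a]
  let R : ∀ v, Submodule K (Fin (β v) → K) := fun v => LinearMap.range (Matrix.mulVecLin (e v))
  let N : ∀ v, Submodule K (Fin (β v) → K) := fun v => LinearMap.ker (Matrix.mulVecLin (e v))
  have hR : ∀ v w, w ∈ R v ↔ e v *ᵥ w = w := by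
    intro v w
    constructor
    · rintro ⟨u, rfl⟩; exact hee' v u
    · intro h; exact ⟨w, h⟩
  have hN : ∀ v w, w ∈ N v ↔ e v *ᵥ w = 0 := fun v w => LinearMap.mem_ker
  have hcompl : ∀ v, IsCompl (R v) (N v) := by
    intro v
    constructor
    · rw [Submodule.disjoint_def]
      intro w h1 h2
      rw [← (hR v w).1 h1, (hN v w).1 h2]
    · rw [codisjoint_iff, eq_top_iff]
      intro w _
      refine Submodule.mem_sup.2 ⟨e v *ᵥ w, ⟨w, rfl⟩, w - e v *ᵥ w, ?_, by abel⟩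
      rw [hN, Matrix.mulVec_sub, hee', sub_self]
  have hxR : ∀ a, ∀ w ∈ R (src a), Matrix.mulVecLin (x a) w ∈ R (tgt a) := by
    intro a w hw
    rw [hR] at hw ⊢
    rw [Matrix.mulVecLin_apply, hcomm, hw]
  have hxN : ∀ a, ∀ w ∈ N (src a), Matrix.mulVecLin (x a) w ∈ N (tgt a) := by
    intro a w hw
    rw [hN] at hw ⊢
    rw [Matrix.mulVecLin_apply, hcomm, hw, Matrix.mulVec_zero]
  let β₁ : I → ℕ := fun v => Module.finrank K (R v)
  let β₂ : I → ℕ := fun v => Module.finrank K (N v)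
  let b₁ : ∀ v, (Fin (β₁ v) → K) ≃ₗ[K] R v := fun v => (Module.finBasis K (R v)).equivFun.symm
  let b₂ : ∀ v, (Fin (β₂ v) → K) ≃ₗ[K] N v := fun v => (Module.finBasis K (N v)).equivFun.symm
  let y : Rep src tgt K β₁ := fun a => LinearMap.toMatrix'
    ((b₁ (tgt a)).symm.toLinearMap ∘ₗ (Matrix.mulVecLin (x a)).restrict (hxR a) ∘ₗ
      (b₁ (src a)).toLinearMap)
  let z : Rep src tgt K β₂ := fun a => LinearMap.toMatrix'
    ((b₂ (tgt a)).symm.toLinearMap ∘ₗ (Matrix.mulVecLin (x a)).restrict (hxN a) ∘ₗ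
      (b₂ (src a)).toLinearMap)
  have hy : ∀ a p, ((b₁ (tgt a) (y a *ᵥ p) : R (tgt a)) : Fin (β (tgt a)) → K)
      = x a *ᵥ (b₁ (src a) p : Fin (β (src a)) → K) := by
    intro a p
    simp only [y, LinearMap.toMatrix'_mulVec]
    simp
  have hz : ∀ a p, ((b₂ (tgt a) (z a *ᵥ p) : N (tgt a)) : Fin (β (tgt a)) → K)
      = x a *ᵥ (b₂ (src a) p : Fin (β (src a)) → K) := by
    intro a p
    simp only [z, LinearMap.toMatrix'_mulVec]
    simp
  let ψ : ∀ v, ((Fin (β₁ v) → K) × (Fin (β₂ v) → K)) ≃ₗ[K] (Fin (β v) → K) := fun v =>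
    ((b₁ v).prodCongr (b₂ v)) ≪≫ₗ Submodule.prodEquivOfIsCompl _ _ (hcompl v)
  have hψ : ∀ v p, ψ v p = (b₁ v p.1 : Fin (β v) → K) + (b₂ v p.2 : Fin (β v) → K) :=
    fun v p => rfl
  refine hx.2 β₁ β₂ y z ?_ ?_ ⟨fun v => (ψ v).symm ≪≫ₗ glue K (β₁ v) (β₂ v), ?_⟩
  · intro h0
    apply hne.1
    funext v
    have : R v = ⊥ := Submodule.finrank_eq_zero.1 (congrFun h0 v)
    have h2 := LinearMap.range_eq_bot.1 this
    apply Matrix.toLin'.injective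
    rw [Matrix.toLin'_apply', h2]
    simp
  · intro h0
    apply hne.2
    funext v
    have : N v = ⊥ := Submodule.finrank_eq_zero.1 (congrFun h0 v)
    apply Matrix.toLin'.injective
    refine LinearMap.ext fun w => ?_
    have h3 : e v *ᵥ w - w ∈ N v := by
      rw [hN, Matrix.mulVec_sub, hee', sub_self]
    rw [this, Submodule.mem_bot, sub_eq_zero] at h3
    simpa using h3
  · intro a
    refine LinearMap.ext fun w => ?_
    obtain ⟨p, rfl⟩ := (ψ (src a)).surjective w
    have h1 : x a *ᵥ (ψ (src a) p) = ψ (tgt a) (y a *ᵥ p.1, z a *ᵥ p.2) := by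
      rw [hψ, hψ, Matrix.mulVec_add, hy, hz]
    have h2 := reindex_fromBlocks_mulVec_glue (y a) (z a) p
    simp only [LinearMap.comp_apply, LinearEquiv.coe_coe, LinearEquiv.trans_apply,
      Matrix.mulVecLin_apply, LinearEquiv.symm_apply_apply]
    erw [h1]
    rw [LinearEquiv.symm_apply_apply]
    exact h2

/-- A nonzero representation whose idempotent endomorphisms are trivial is indecomposable. -/
lemma indec_of_idempotent {K : Type} [Field K] {β : I → ℕ} {x : Rep src tgt K β} (hβ : β ≠ 0)
    (H : ∀ e ∈ endAlg x, e * e = e → e = 0 ∨ e = 1) : Indec src tgt x := by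
  refine ⟨hβ, fun β₁ β₂ y z h₁ h₂ => ?_⟩
  rintro ⟨φ, hφ⟩
  let ψ : ∀ v, ((Fin (β₁ v) → K) × (Fin (β₂ v) → K)) ≃ₗ[K] (Fin (β v) → K) := fun v =>
    glue K (β₁ v) (β₂ v) ≪≫ₗ (φ v).symm
  have hψ : ∀ a p, x a *ᵥ (ψ (src a) p) = ψ (tgt a) (y a *ᵥ p.1, z a *ᵥ p.2) := by
    intro a p
    apply (φ (tgt a)).injective
    have h := LinearMap.congr_fun (hφ a) (ψ (src a) p)
    simp only [LinearMap.comp_apply, LinearEquiv.coe_coe, Matrix.mulVecLin_apply] at h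
    refine h.symm.trans ?_
    have h2 := reindex_fromBlocks_mulVec_glue (y a) (z a) p
    simp only [ψ, LinearEquiv.trans_apply, LinearEquiv.apply_symm_apply]
    exact h2
  let P : ∀ v, (Fin (β v) → K) →ₗ[K] (Fin (β v) → K) := fun v =>
    (ψ v).toLinearMap ∘ₗ (LinearMap.inl K _ _ ∘ₗ LinearMap.fst K _ _) ∘ₗ (ψ v).symm.toLinearMap
  have hP : ∀ v p, P v (ψ v p) = ψ v (p.1, 0) := by
    intro v p
    simp [P]
  let e : ∀ v, Matrix (Fin (β v)) (Fin (β v)) K := fun v => LinearMap.toMatrix' (P v)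
  have he : ∀ v w, e v *ᵥ w = P v w := fun v w => LinearMap.toMatrix'_mulVec _ _
  have hext : ∀ {m n : ℕ} (A B : Matrix (Fin m) (Fin n) K), (∀ w, A *ᵥ w = B *ᵥ w) → A = B := by
    intro m n A B h
    apply Matrix.toLin'.injective
    exact LinearMap.ext fun w => by simpa using h w
  rcases H e (by
    intro a
    apply hext
    intro w
    obtain ⟨p, rfl⟩ := (ψ (src a)).surjective w
    rw [← Matrix.mulVec_mulVec, ← Matrix.mulVec_mulVec, hψ, he, he, hP, hP, hψ]
    simp) (by
    funext v
    apply hext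
    intro w
    obtain ⟨p, rfl⟩ := (ψ v).surjective w
    rw [Pi.mul_apply, ← Matrix.mulVec_mulVec, he, he, hP, hP]) with h | h
  · obtain ⟨v, hv⟩ := Function.ne_iff.1 h₁
    have h0 := he v (ψ v (fun _ => 1, 0))
    rw [h, hP] at h0
    simp only [Pi.zero_apply, Matrix.zero_mulVec] at h0
    have h2 := (ψ v).map_eq_zero_iff.1 h0.symm
    have h3 := congrFun (congrArg Prod.fst h2) ⟨0, Nat.pos_of_ne_zero hv⟩
    simp at h3
  · obtain ⟨v, hv⟩ := Function.ne_iff.1 h₂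
    have h0 := he v (ψ v (0, fun _ => 1))
    rw [h, hP] at h0
    simp only [Pi.one_apply, Matrix.one_mulVec] at h0
    have h2 := (ψ v).injective h0
    have h3 := congrFun (congrArg Prod.snd h2) ⟨0, Nat.pos_of_ne_zero hv⟩
    simp at h3

end QRep

namespace QRep

lemma coe_aeval_restrict {F V : Type} [Field F] [AddCommGroup V] [Module F V] (T : Module.End F V)
    (W : Submodule F V) (hW : ∀ w ∈ W, T w ∈ W) (h : Polynomial F) (w : W) :
    ((Polynomial.aeval (T.restrict hW : Module.End F W) h w : W) : V)
      = Polynomial.aeval T h (w : V) := by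
  induction h using Polynomial.induction_on' generalizing w with
  | add p q hp hq => simp [hp, hq]
  | monomial n a =>
    have : ∀ (n : ℕ) (w : W), (((T.restrict hW : Module.End F W) ^ n) w : V) = (T ^ n) (w : V) := by
      intro n
      induction n with
      | zero => intro w; simp
      | succ n ih => intro w; rw [pow_succ, pow_succ, Module.End.mul_apply, ih]; rfl
    simp [Polynomial.aeval_monomial, this]

variable {I Ω : Type} {src tgt : Ω → I}

/-- An endomorphism with squarefree minimal polynomial over a finite field produces a dimension
vector `δ` such that all the vectors `u ^ δ` are determinants of endomorphisms; if `δ` is the full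
dimension vector, then the endomorphism is scalar. -/
lemma exists_dimVec_of_squarefree_minpoly [Fintype I] {F : Type} [Field F] [Fintype F] {β : I → ℕ}
    (v₀ : I) (hβ : β v₀ ≠ 0) (x : Rep src tgt F β) (t : ∀ v, Matrix (Fin (β v)) (Fin (β v)) F)
    (ht : t ∈ endAlg x) (hsq : Squarefree (minpoly F t)) :
    ∃ δ : I → ℕ, δ ≠ 0 ∧ (∀ v, δ v ≤ β v) ∧
      (∀ a, Function.Injective (Matrix.mulVecLin (x a)) → δ (src a) ≤ δ (tgt a)) ∧
      (∀ u : Fˣ, ∃ g ∈ endAlg x, ∀ v, (g v).det = (u : F) ^ δ v) ∧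
      (δ = β → ∃ a : F, t = algebraMap F _ a) := by
  classical
  have : Nonempty (Fin (β v₀)) := ⟨⟨0, Nat.pos_of_ne_zero hβ⟩⟩
  have : Nontrivial (∀ v, Matrix (Fin (β v)) (Fin (β v)) F) := Pi.nontrivial_at v₀
  have h_integral : IsIntegral F t := Algebra.IsIntegral.isIntegral t
  obtain ⟨p, hp, g, hg⟩ := WfDvdMonoid.exists_irreducible_factor (minpoly.not_isUnit F t)
    (minpoly.ne_zero h_integral)
  have hcop : IsCoprime p g := by
    rw [hp.coprime_iff_not_dvd]
    rintro ⟨g', hg'⟩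
    exact hp.not_isUnit (hsq p ⟨g', by rw [hg, hg']; ring⟩)
  obtain ⟨aa, bb, hab⟩ := hcop
  have hzero : Polynomial.aeval t p * Polynomial.aeval t g = 0 := by
    rw [← map_mul, ← hg, minpoly.aeval]
  let Φ : ∀ v, (∀ v, Matrix (Fin (β v)) (Fin (β v)) F) →ₐ[F] Module.End F (Fin (β v) → F) :=
    fun v => (Matrix.toLinAlgEquiv' (R := F) (n := Fin (β v))).toAlgHom.comp (Pi.evalAlgHom F _ v)
  have hΦ : ∀ v s w, Φ v s w = s v *ᵥ w := fun v s w => rfl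
  have hΦa : ∀ v (h : Polynomial F), Φ v (Polynomial.aeval t h) = Polynomial.aeval (Φ v t) h :=
    fun v h => (Polynomial.aeval_algHom_apply _ _ _).symm
  let W : ∀ v, Submodule F (Fin (β v) → F) := fun v => LinearMap.ker (Polynomial.aeval (Φ v t) p)
  have hWmem : ∀ v w, w ∈ W v ↔ Polynomial.aeval t p v *ᵥ w = 0 := by
    intro v w
    rw [LinearMap.mem_ker, ← hΦa, hΦ]
  have hWst : ∀ (h : Polynomial F) v, ∀ w ∈ W v, Polynomial.aeval (Φ v t) h w ∈ W v := by
    intro h v w hw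
    rw [LinearMap.mem_ker] at hw ⊢
    rw [← Module.End.mul_apply, ← map_mul, mul_comm, map_mul, Module.End.mul_apply, hw, map_zero]
  have hWst1 : ∀ v, ∀ w ∈ W v, Φ v t w ∈ W v := by
    intro v w hw
    have := hWst Polynomial.X v w hw
    rwa [Polynomial.aeval_X] at this
  let Tr : ∀ v, Module.End F (W v) := fun v => (Φ v t).restrict (hWst1 v)
  have hTr : ∀ v (h : Polynomial F) (w : W v), ((Polynomial.aeval (Tr v) h w : W v) : Fin (β v) → F)
      = Polynomial.aeval (Φ v t) h w := fun v h w => coe_aeval_restrict _ _ _ h w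
  have : Fact (Irreducible p) := ⟨hp⟩
  have hfd : FiniteDimensional F (AdjoinRoot p) := (AdjoinRoot.powerBasis hp.ne_zero).finite
  have hd : Module.finrank F (AdjoinRoot p) = p.natDegree := by
    rw [(AdjoinRoot.powerBasis hp.ne_zero).finrank, AdjoinRoot.powerBasis_dim]
  let ρ : ∀ v, AdjoinRoot p →ₐ[F] Module.End F (W v) := fun v =>
    Ideal.Quotient.liftₐ (Ideal.span {p}) (Polynomial.aeval (Tr v)) (by
      intro h hh
      obtain ⟨c, rfl⟩ := Ideal.mem_span_singleton.1 hh
      refine LinearMap.ext fun w => Subtype.ext ?_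
      rw [hTr, mul_comm, map_mul, Module.End.mul_apply, LinearMap.mem_ker.1 w.2, map_zero]
      rfl)
  have hρ : ∀ v (h : Polynomial F), ρ v (AdjoinRoot.mk p h) = Polynomial.aeval (Tr v) h :=
    fun v h => rfl
  choose δ hδ hdet using fun v => exists_det_eq_norm_pow (ρ v)
  have hdpos : 0 < p.natDegree := hp.natDegree_pos
  rw [hd] at hδ
  have hδle : ∀ v, p.natDegree * δ v ≤ β v := by
    intro v
    rw [← hδ]
    simpa using Submodule.finrank_le (W v)
  refine ⟨δ, ?_, ?_, ?_, ?_, ?_⟩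
  · intro h0
    have hker : ∀ v, W v = ⊥ := by
      intro v
      apply Submodule.finrank_eq_zero.1
      rw [hδ, h0]; simp
    have hg0 : Polynomial.aeval t g = 0 := by
      funext v
      apply Matrix.toLin'.injective
      refine LinearMap.ext fun w => ?_
      have h1 : Polynomial.aeval t g v *ᵥ w ∈ W v := by
        rw [hWmem, Matrix.mulVec_mulVec, ← Pi.mul_apply, hzero]
        simp
      rw [hker, Submodule.mem_bot] at h1
      simpa using h1
    have h2 := minpoly.dvd F t hg0
    have hg_ne : g ≠ 0 := by
      rintro rfl
      exact minpoly.ne_zero h_integral (by rw [hg, mul_zero])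
    obtain ⟨c, hc⟩ := h2
    apply hp.not_isUnit
    apply IsUnit.of_mul_eq_one c
    apply mul_left_cancel₀ hg_ne
    rw [hg] at hc
    rw [mul_one]
    calc g * (p * c) = p * g * c := by ring
      _ = g := hc.symm
  · exact fun v => (Nat.le_mul_of_pos_left _ hdpos).trans (hδle v)
  · intro a ha
    refine Nat.le_of_mul_le_mul_left ?_ hdpos
    rw [← hδ, ← hδ, (Submodule.equivMapOfInjective _ ha (W (src a))).finrank_eq]
    apply Submodule.finrank_mono
    rintro _ ⟨w, hw, rfl⟩
    have hmem : Polynomial.aeval t p ∈ endAlg x :=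
      (Algebra.adjoin_le (Set.singleton_subset_iff.2 ht))
        (Polynomial.aeval_mem_adjoin_singleton F t)
    have hw' := (hWmem _ _).1 hw
    rw [hWmem, Matrix.mulVecLin_apply, Matrix.mulVec_mulVec, hmem a, ← Matrix.mulVec_mulVec, hw',
      Matrix.mulVec_zero]
  · intro u
    have : Finite (AdjoinRoot p) := Module.finite_of_finite F
    obtain ⟨c, hc⟩ := FiniteField.norm_surjective F (AdjoinRoot p) (u : F)
    obtain ⟨l, rfl⟩ := AdjoinRoot.mk_surjective c
    let h := l * (bb * g) + aa * p
    have hmk : AdjoinRoot.mk p h = AdjoinRoot.mk p l := by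
      rw [AdjoinRoot.mk_eq_mk]
      exact ⟨aa * (1 - l), by simp only [h]; linear_combination l * hab⟩
    refine ⟨Polynomial.aeval t h, (Algebra.adjoin_le (Set.singleton_subset_iff.2 ht))
        (Polynomial.aeval_mem_adjoin_singleton F t), fun v => ?_⟩
    have h1 : (Polynomial.aeval t h v).det = LinearMap.det (Φ v (Polynomial.aeval t h)) := by
      rw [← LinearMap.det_toLin']; rfl
    rw [h1, hΦa, LinearMap.det_eq_det_mul_det (W v) _ (hWst h v)]
    have h2 : (Polynomial.aeval (Φ v t) h).restrict (hWst h v) = ρ v (AdjoinRoot.mk p l) := by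
      rw [← hmk, hρ]
      refine LinearMap.ext fun w => Subtype.ext ?_
      rw [hTr]; rfl
    have h3 : (W v).mapQ (W v) (Polynomial.aeval (Φ v t) h) (hWst h v) = LinearMap.id := by
      refine LinearMap.ext fun w => ?_
      obtain ⟨w, rfl⟩ := Submodule.Quotient.mk_surjective _ w
      rw [Submodule.mapQ_apply, LinearMap.id_apply, Submodule.Quotient.eq]
      have h4 : Polynomial.aeval (Φ v t) h w - w
          = Polynomial.aeval (Φ v t) ((l - 1) * bb * g) w := by
        have : (l - 1) * bb * g = h - 1 := by
          simp only [h]; linear_combination -hab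
        rw [this, map_sub, map_one]; rfl
      rw [h4, mul_comm, map_mul, Module.End.mul_apply, LinearMap.mem_ker, ← Module.End.mul_apply,
        ← map_mul, ← hΦa, map_mul, hzero, map_zero]
      rfl
    rw [h2, h3, hdet, hc, LinearMap.det_id, mul_one]
  · rintro rfl
    have hd1 : p.natDegree = 1 := by
      have := hδle v₀
      have : p.natDegree ≤ 1 := by
        by_contra hlt
        have h2 : 2 * δ v₀ ≤ p.natDegree * δ v₀ := Nat.mul_le_mul_right _ (by omega)
        omega
      omega
    have hp0 : Polynomial.aeval t p = 0 := by
      funext v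
      have htop : W v = ⊤ := by
        apply Submodule.eq_top_of_finrank_eq
        rw [hδ, hd1, one_mul]; simp
      apply Matrix.toLin'.injective
      refine LinearMap.ext fun w => ?_
      have : w ∈ W v := by rw [htop]; trivial
      rw [hWmem] at this
      simpa using this
    obtain ⟨a, b, hpab⟩ := Polynomial.exists_eq_X_add_C_of_natDegree_le_one hd1.le
    have ha : a ≠ 0 := by
      rintro rfl
      rw [hpab] at hd1
      simp at hd1
    refine ⟨-(b / a), ?_⟩
    rw [hpab] at hp0
    simp only [map_add, map_mul, Polynomial.aeval_C, Polynomial.aeval_X] at hp0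
    have hinv :
        algebraMap F (∀ v, Matrix (Fin (δ v)) (Fin (δ v)) F) a⁻¹ * algebraMap F _ a = 1 := by
      rw [← map_mul, inv_mul_cancel₀ ha, map_one]
    have h5 := congrArg (algebraMap F _ a⁻¹ * ·) hp0
    simp only [mul_add, ← mul_assoc, hinv, one_mul, mul_zero, ← map_mul] at h5
    rw [map_neg, eq_neg_iff_add_eq_zero, div_eq_inv_mul]
    exact h5

end QRep

namespace QRep

section Star

variable {F : Type} [Field F] {k m : ℕ} {s : Fin k → ℕ} {β : StarV k s → ℕ}

/-- The matrix attached to a loop. -/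
def loopMat (x : Rep (starSrc k m s) (starTgt k m s) F β) (r : Fin m) :
    Matrix (Fin (β none)) (Fin (β none)) F := x (.inl r)

/-- The linear map attached to an arrow of a leg. -/
def legMap (x : Rep (starSrc k m s) (starTgt k m s) F β) (a : (i : Fin k) × Fin (s i)) :
    (Fin (β (some a)) → F) →ₗ[F] (Fin (β (legPrev k s a)) → F) :=
  Matrix.mulVecLin (x (.inr a))

/-- The composition of the maps along a leg, from the `j`-th vertex to the central one. -/
def toRootAux (x : Rep (starSrc k m s) (starTgt k m s) F β) (i : Fin k) :
    ∀ (j : ℕ) (hj : j < s i), (Fin (β (some ⟨i, ⟨j, hj⟩⟩)) → F) →ₗ[F] (Fin (β none) → F)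
  | 0, hj => legMap x ⟨i, ⟨0, hj⟩⟩
  | j + 1, hj => (toRootAux x i j (Nat.lt_of_succ_lt hj)).comp (legMap x ⟨i, ⟨j + 1, hj⟩⟩)

/-- The composition of the maps along a leg, from any vertex to the central one. -/
def toRoot (x : Rep (starSrc k m s) (starTgt k m s) F β) :
    ∀ v : StarV k s, (Fin (β v) → F) →ₗ[F] (Fin (β none) → F)
  | none => LinearMap.id
  | some ⟨i, ⟨j, hj⟩⟩ => toRootAux x i j hj

lemma toRoot_none (x : Rep (starSrc k m s) (starTgt k m s) F β) :
    toRoot x none = LinearMap.id := rfl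

lemma toRoot_some (x : Rep (starSrc k m s) (starTgt k m s) F β) (a : (i : Fin k) × Fin (s i)) :
    toRoot x (some a) = (toRoot x (legPrev k s a)).comp (legMap x a) := by
  obtain ⟨i, ⟨j, hj⟩⟩ := a
  cases j <;> rfl

/-- On every leg, the kernels of the maps to the central vertex have compatible complements. -/
lemma exists_isCompl_ker_toRootAux (x : Rep (starSrc k m s) (starTgt k m s) F β) (i : Fin k)
    (j : ℕ) (hj : j ≤ s i) :
    ∃ C : ∀ l : Fin (s i), Submodule F (Fin (β (some ⟨i, l⟩)) → F),
      ∀ l : Fin (s i), j ≤ l.1 → IsCompl (C l) (LinearMap.ker (toRoot x (some ⟨i, l⟩))) ∧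
        ∀ h : l.1 + 1 < s i, ∀ w ∈ C ⟨l.1 + 1, h⟩, legMap x ⟨i, ⟨l.1 + 1, h⟩⟩ w ∈ C l := by
  induction hj using Nat.decreasingInduction with
  | self => exact ⟨fun _ => ⊥, fun l hl => absurd l.2 (by omega)⟩
  | of_succ j hj ih =>
    obtain ⟨C, hC⟩ := ih
    let jj : Fin (s i) := ⟨j, hj⟩
    have hdis : Disjoint (⨆ h : j + 1 < s i, (C ⟨j + 1, h⟩).map (legMap x ⟨i, ⟨j + 1, h⟩⟩))
        (LinearMap.ker (toRoot x (some ⟨i, jj⟩))) := by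
      by_cases h : j + 1 < s i
      · rw [iSup_pos h, Submodule.disjoint_def]
        rintro _ ⟨w, hw, rfl⟩ hk
        have h1 : w ∈ LinearMap.ker (toRoot x (some ⟨i, ⟨j + 1, h⟩⟩)) := by
          rw [LinearMap.mem_ker] at hk ⊢
          rw [toRoot_some]
          exact hk
        have h2 := Submodule.disjoint_def.1 (hC ⟨j + 1, h⟩ le_rfl).1.disjoint w hw h1
        exact (congrArg _ h2).trans (map_zero (legMap x ⟨i, ⟨j + 1, h⟩⟩))
      · simp [h]
    obtain ⟨D, hD, hDc⟩ := hdis.exists_isCompl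
    refine ⟨Function.update C jj D, fun l hl => ?_⟩
    by_cases hlj : l = jj
    · subst hlj
      rw [Function.update_self]
      refine ⟨hDc, fun h w hw => hD ?_⟩
      rw [Function.update_of_ne (by simp [jj, Fin.ext_iff])] at hw
      rw [iSup_pos h]
      exact ⟨w, hw, rfl⟩
    · have hne : l.1 ≠ j := fun h => hlj (Fin.ext h)
      rw [Function.update_of_ne hlj]
      refine ⟨(hC l (by omega)).1, fun h w hw => (hC l (by omega)).2 h w ?_⟩
      rwa [Function.update_of_ne (by simp only [ne_eq, Fin.ext_iff, jj]; omega)] at hw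

lemma matrix_ext_mulVec {p q : ℕ} {A B : Matrix (Fin p) (Fin q) F}
    (h : ∀ w, A *ᵥ w = B *ᵥ w) : A = B := by
  apply Matrix.toLin'.injective
  exact LinearMap.ext fun w => by simpa using h w

lemma mem_endAlg_star {x : Rep (starSrc k m s) (starTgt k m s) F β}
    {t : ∀ v, Matrix (Fin (β v)) (Fin (β v)) F} :
    t ∈ endAlg x ↔ (∀ r, t none * loopMat x r = loopMat x r * t none) ∧
      ∀ a w, t (legPrev k s a) *ᵥ legMap x a w = legMap x a (t (some a) *ᵥ w) := by
  refine ⟨fun h => ⟨fun r => h (.inl r), fun a w => ?_⟩, fun h => ?_⟩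
  · exact (Matrix.mulVec_mulVec w _ _).trans
      ((congrArg (· *ᵥ w) (h (.inr a))).trans (Matrix.mulVec_mulVec w _ _).symm)
  · rintro (r | a)
    · exact h.1 r
    · apply matrix_ext_mulVec
      intro w
      rw [← Matrix.mulVec_mulVec, ← Matrix.mulVec_mulVec]
      exact h.2 a w

lemma toRoot_injective_of_idempotent (h0 : β none ≠ 0)
    (x : Rep (starSrc k m s) (starTgt k m s) F β)
    (H : ∀ e ∈ endAlg x, e * e = e → e = 0 ∨ e = 1) (v : StarV k s) :
    Function.Injective (toRoot x v) := by
  choose C hC using fun i => exists_isCompl_ker_toRootAux x i 0 (Nat.zero_le _)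
  let D : ∀ v : StarV k s, Submodule F (Fin (β v) → F) := fun v => match v with
    | none => ⊤
    | some ⟨i, l⟩ => C i l
  have hD : ∀ v, IsCompl (LinearMap.ker (toRoot x v)) (D v) := by
    rintro (_ | ⟨i, l⟩)
    · rw [toRoot_none, LinearMap.ker_id]
      exact isCompl_bot_top
    · exact (hC i l (Nat.zero_le _)).1.symm
  have hDx : ∀ a, ∀ w ∈ D (some a), legMap x a w ∈ D (legPrev k s a) := by
    rintro ⟨i, ⟨j, hj⟩⟩ w hw
    cases j with
    | zero => trivial
    | succ j => exact (hC i ⟨j, Nat.lt_of_succ_lt hj⟩ (Nat.zero_le _)).2 hj w hw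
  let P : ∀ v, (Fin (β v) → F) →ₗ[F] (Fin (β v) → F) := fun v => Submodule.projection _ _ (hD v)
  have hPK : ∀ v, ∀ w ∈ LinearMap.ker (toRoot x v), P v w = w := fun v w hw =>
    Submodule.projection_apply_of_mem_left (hD v) hw
  have hPD : ∀ v, ∀ w ∈ D v, P v w = 0 := fun v w hw =>
    Submodule.projection_apply_of_mem_right (hD v) hw
  let e : ∀ v, Matrix (Fin (β v)) (Fin (β v)) F := fun v => LinearMap.toMatrix' (P v)
  have he : ∀ v w, e v *ᵥ w = P v w := fun v w => LinearMap.toMatrix'_mulVec _ _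
  have he0 : e none = 0 := by
    apply matrix_ext_mulVec
    intro w
    rw [he, hPD _ _ (by trivial), Matrix.zero_mulVec]
  have hend : e ∈ endAlg x := by
    rw [mem_endAlg_star]
    refine ⟨fun r => by rw [he0, Matrix.zero_mul, Matrix.mul_zero], fun a w => ?_⟩
    rw [he, he]
    obtain ⟨κ, hκ, c, hc, rfl⟩ := Submodule.mem_sup.1
      ((hD (some a)).sup_eq_top ▸ Submodule.mem_top : w ∈ _ ⊔ _)
    have hκ' : legMap x a κ ∈ LinearMap.ker (toRoot x (legPrev k s a)) := by
      rw [LinearMap.mem_ker, toRoot_some] at hκ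
      exact hκ
    rw [map_add, map_add, map_add, map_add, hPK _ κ hκ, hPD _ c hc, hPK _ _ hκ',
      hPD _ _ (hDx a c hc), map_zero]
  have hidem : e * e = e := by
    funext v
    apply matrix_ext_mulVec
    intro w
    rw [Pi.mul_apply, ← Matrix.mulVec_mulVec, he, he]
    exact hPK v _ (Submodule.projection_apply_mem (hD v) w)
  rcases H e hend hidem with h | h
  · rw [← LinearMap.ker_eq_bot, Submodule.eq_bot_iff]
    intro w hw
    rw [← hPK v w hw, ← he, h]
    simp
  · exfalso
    rw [h] at he0
    have := congrFun (congrFun he0 ⟨0, Nat.pos_of_ne_zero h0⟩) ⟨0, Nat.pos_of_ne_zero h0⟩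
    simp at this

lemma legMap_injective {x : Rep (starSrc k m s) (starTgt k m s) F β}
    (hx : ∀ v, Function.Injective (toRoot x v)) (a : (i : Fin k) × Fin (s i)) :
    Function.Injective (legMap x a) := by
  have := hx (some a)
  rw [toRoot_some, LinearMap.coe_comp] at this
  exact this.of_comp

lemma toRoot_injective_of_indec_baseChange {L : Type} [Field L] (f : F →+* L) (h0 : β none ≠ 0)
    (x : Rep (starSrc k m s) (starTgt k m s) F β)
    (hx : Indec (starSrc k m s) (starTgt k m s)
      (baseChange (starSrc k m s) (starTgt k m s) f x)) (v : StarV k s) :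
    Function.Injective (toRoot x v) := by
  refine toRoot_injective_of_idempotent h0 x (fun e he hee => ?_) v
  rcases hx.idempotent (piMap f β e) (piMap_mem_endAlg f he) (by rw [← map_mul, hee]) with h | h
  · exact .inl (piMap_injective f β (h.trans (map_zero _).symm))
  · exact .inr (piMap_injective f β (h.trans (map_one _).symm))

lemma det_eq_pow_of_isNilpotent_sub {K : Type} [Field K] {p : ℕ} {g : Matrix (Fin p) (Fin p) K}
    {a : K} (h : IsNilpotent (g - algebraMap K _ a)) : g.det = a ^ p := by
  have h1 := (Matrix.isNilpotent_charpoly_sub_pow_of_isNilpotent h.neg).eq_zero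
  rw [sub_eq_zero] at h1
  have h2 := Matrix.eval_charpoly (-(g - algebraMap K _ a)) a
  rw [h1] at h2
  simp only [Polynomial.eval_pow, Polynomial.eval_X, Fintype.card_fin] at h2
  rw [h2]
  congr 1
  rw [Matrix.algebraMap_eq_diagonal, Matrix.scalar_apply, neg_sub, sub_sub_eq_add_sub]
  exact (add_sub_cancel_left _ _).symm

lemma exists_det_eq_pow_of_indec_baseChange [Fintype F] {L : Type} [Field L] [IsAlgClosed L]
    [Algebra F L]
    (h0 : β none ≠ 0) (x : Rep (starSrc k m s) (starTgt k m s) F β)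
    (hx : Indec (starSrc k m s) (starTgt k m s)
      (baseChange (starSrc k m s) (starTgt k m s) (algebraMap F L) x))
    (t) (ht : t ∈ endAlg x) : ∃ a : F, ∀ v, (t v).det = a ^ β v := by
  obtain ⟨a, ha⟩ :=
    scalar_add_nilpotent_of_idempotent_baseChange (L := L) none h0 x hx.idempotent t ht
  exact ⟨a, fun v => det_eq_pow_of_isNilpotent_sub (ha.map (Pi.evalRingHom _ v))⟩

lemma indec_baseChange_of_det {L : Type} [Field L] [Algebra F L] [Fintype F]
    (h0 : β none ≠ 0) (x : Rep (starSrc k m s) (starTgt k m s) F β)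
    (hx : ∀ v, Function.Injective (toRoot x v)) (σ : StarV k s → (Fˣ →* ℂˣ))
    (hgen : ∀ δ : StarV k s → ℕ, NonIncr k s δ → δ ≠ 0 →
      (∀ v, δ v ≤ β v) → δ ≠ β → ∏ v, σ v ^ δ v ≠ 1)
    (hσ : ∀ t ∈ endAlg x, ∀ d : StarV k s → Fˣ, (∀ v, (t v).det = d v) → ∏ v, σ v (d v) = 1) :
    Indec (starSrc k m s) (starTgt k m s)
      (baseChange (starSrc k m s) (starTgt k m s) (algebraMap F L) x) := by
  classical
  have hne : Nonempty (Fin (β none)) := ⟨⟨0, Nat.pos_of_ne_zero h0⟩⟩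
  have : Nontrivial (∀ v, Matrix (Fin (β v)) (Fin (β v)) F) := Pi.nontrivial_at none
  refine indec_of_idempotent (fun h => h0 (congrFun h none))
    (idempotent_baseChange_of_scalar_add_nilpotent x fun t ht => ?_)
  obtain ⟨N, hN⟩ := exists_pow_card_minpoly_squarefree F t
  obtain ⟨δ, hδ0, hδβ, hδs, hδu, hδ⟩ :=
    exists_dimVec_of_squarefree_minpoly none h0 x _ (pow_mem ht _) hN
  have hδeq : δ = β := by
    by_contra hne
    refine hgen δ (fun a => hδs (.inr a) (legMap_injective hx a)) hδ0 hδβ hne ?_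
    refine MonoidHom.ext fun u => ?_
    obtain ⟨g, hg, hdet⟩ := hδu u
    have := hσ g hg (fun v => u ^ δ v) (fun v => by rw [hdet, Units.val_pow_eq_pow_val])
    simp only [map_pow] at this
    rw [MonoidHom.finsetProd_apply]
    simpa using this
  obtain ⟨a, ha⟩ := hδ hδeq
  exact ⟨a, isNilpotent_sub_of_pow_card_eq ha⟩

end Star

end QRep

namespace QRep

/-- Decreasing flags of subspaces of `F ^ n` with prescribed dimensions. -/
abbrev Flag (F : Type) [Field F] (n : ℕ) (β : ℕ → ℕ) : Type :=
  {V : ℕ → Submodule F (Fin n → F) //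
    V 0 = ⊤ ∧ (∀ j, V (j + 1) ≤ V j) ∧ ∀ j, Module.finrank F (V j) = β j}

lemma finite_flag (F : Type) [Field F] [Finite F] (n : ℕ) {β : ℕ → ℕ} (l : ℕ)
    (hβ : ∀ j, l < j → β j = 0) : Finite (Flag F n β) := by
  have : Finite (Submodule F (Fin n → F)) := Finite.of_injective _ SetLike.coe_injective
  refine Finite.of_injective
    (fun V : Flag F n β => fun j : Fin (l + 1) => V.1 j) fun V W h =>
      Subtype.ext (funext fun j => ?_)
  by_cases hj : j < l + 1
  · exact congrFun h ⟨j, hj⟩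
  · have hz : ∀ V : Flag F n β, V.1 j = ⊥ := fun V =>
      Submodule.finrank_eq_zero.1 ((V.2.2.2 j).trans (hβ j (by omega)))
    rw [hz, hz]

/-- The linear map attached to an invertible matrix. -/
abbrev glLin {F : Type} [Field F] {n : ℕ} (h : GL (Fin n) F) : (Fin n → F) →ₗ[F] (Fin n → F) :=
  Matrix.mulVecLin (h : Matrix (Fin n) (Fin n) F)

lemma glLin_mul {F : Type} [Field F] {n : ℕ} (g h : GL (Fin n) F) :
    glLin (g * h) = (glLin g).comp (glLin h) := by
  simp [glLin, Matrix.mulVecLin_mul]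

lemma glLin_one {F : Type} [Field F] {n : ℕ} : glLin (1 : GL (Fin n) F) = LinearMap.id := by
  simp [glLin]

lemma glLin_inv_apply {F : Type} [Field F] {n : ℕ} (h : GL (Fin n) F) (w : Fin n → F) :
    glLin h⁻¹ (glLin h w) = w := by
  rw [← LinearMap.comp_apply, ← glLin_mul, inv_mul_cancel, glLin_one, LinearMap.id_apply]

lemma glLin_apply_inv {F : Type} [Field F] {n : ℕ} (h : GL (Fin n) F) (w : Fin n → F) :
    glLin h (glLin h⁻¹ w) = w := by
  rw [← LinearMap.comp_apply, ← glLin_mul, mul_inv_cancel, glLin_one, LinearMap.id_apply]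

lemma glLin_injective {F : Type} [Field F] {n : ℕ} (h : GL (Fin n) F) :
    Function.Injective (glLin h) := Function.LeftInverse.injective (glLin_inv_apply h)

/-- A tuple of matrices and a tuple of flags. -/
@[ext] structure StarDatum (F : Type) [Field F] (k m n : ℕ) (β : Fin k → ℕ → ℕ) where
  /-- the matrices -/
  mat : Fin m → Matrix (Fin n) (Fin n) F
  /-- the flags -/
  flag : ∀ i, Flag F n (β i)

variable {F : Type} [Field F] {k m n : ℕ} {β : Fin k → ℕ → ℕ}

/-- `GL_n` acts by conjugation on the matrices and by translation on the flags. -/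
instance : MulAction (GL (Fin n) F) (StarDatum F k m n β) where
  smul h p :=
    { mat := fun r => (h : Matrix (Fin n) (Fin n) F) * p.mat r *
        ((h⁻¹ : GL (Fin n) F) : Matrix (Fin n) (Fin n) F)
      flag := fun i => ⟨fun j => ((p.flag i).1 j).map (glLin h), by
        refine ⟨?_, fun j => Submodule.map_mono ((p.flag i).2.2.1 j), fun j => ?_⟩
        · change ((p.flag i).1 0).map (glLin h) = ⊤
          rw [(p.flag i).2.1, Submodule.map_top, LinearMap.range_eq_top]
          exact Function.RightInverse.surjective (glLin_apply_inv h)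
        · rw [← (Submodule.equivMapOfInjective _ (glLin_injective h) _).finrank_eq]
          exact (p.flag i).2.2.2 j⟩ }
  one_smul p := by
    refine StarDatum.ext (funext fun r => ?_) (funext fun i => Subtype.ext (funext fun j => ?_))
    · change ((1 : GL (Fin n) F) : Matrix (Fin n) (Fin n) F) * p.mat r *
        (((1 : GL (Fin n) F)⁻¹ : GL (Fin n) F) : Matrix (Fin n) (Fin n) F) = p.mat r
      simp
    · change ((p.flag i).1 j).map (glLin 1) = (p.flag i).1 j
      rw [glLin_one, Submodule.map_id]
  mul_smul g h p := by
    refine StarDatum.ext (funext fun r => ?_) (funext fun i => Subtype.ext (funext fun j => ?_))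
    · change ((g * h : GL (Fin n) F) : Matrix (Fin n) (Fin n) F) * p.mat r *
          (((g * h)⁻¹ : GL (Fin n) F) : Matrix (Fin n) (Fin n) F) =
        (g : Matrix (Fin n) (Fin n) F) * ((h : Matrix (Fin n) (Fin n) F) * p.mat r *
          ((h⁻¹ : GL (Fin n) F) : Matrix (Fin n) (Fin n) F)) *
          ((g⁻¹ : GL (Fin n) F) : Matrix (Fin n) (Fin n) F)
      rw [_root_.mul_inv_rev, Units.val_mul, Units.val_mul]
      simp only [Matrix.mul_assoc]
    · change ((p.flag i).1 j).map (glLin (g * h)) = (((p.flag i).1 j).map (glLin h)).map (glLin g)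
      rw [glLin_mul, Submodule.map_comp]

lemma smul_mat (h : GL (Fin n) F) (p : StarDatum F k m n β) (r : Fin m) :
    (h • p).mat r = (h : Matrix (Fin n) (Fin n) F) * p.mat r *
      ((h⁻¹ : GL (Fin n) F) : Matrix (Fin n) (Fin n) F) := rfl

lemma smul_flag (h : GL (Fin n) F) (p : StarDatum F k m n β) (i : Fin k) (j : ℕ) :
    ((h • p).flag i).1 j = ((p.flag i).1 j).map (glLin h) := rfl

lemma smul_eq_iff {h : GL (Fin n) F} {p q : StarDatum F k m n β} :
    h • p = q ↔ (∀ r, (h : Matrix (Fin n) (Fin n) F) * p.mat r =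
      q.mat r * (h : Matrix (Fin n) (Fin n) F)) ∧
      ∀ i j, ∀ w ∈ (p.flag i).1 j, glLin h w ∈ (q.flag i).1 j := by
  constructor
  · rintro rfl
    refine ⟨fun r => ?_, fun i j w hw => ⟨w, hw, rfl⟩⟩
    rw [smul_mat, Matrix.mul_assoc _ _ (h : Matrix (Fin n) (Fin n) F), ← Units.val_mul,
      inv_mul_cancel, Units.val_one, Matrix.mul_one]
  · rintro ⟨h1, h2⟩
    refine StarDatum.ext (funext fun r => ?_) (funext fun i => Subtype.ext (funext fun j => ?_))
    · rw [smul_mat, h1, Matrix.mul_assoc, ← Units.val_mul, mul_inv_cancel, Units.val_one,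
        Matrix.mul_one]
    · rw [smul_flag]
      apply Submodule.eq_of_le_of_finrank_eq
      · rintro _ ⟨w, hw, rfl⟩
        exact h2 i j w hw
      · rw [← (Submodule.equivMapOfInjective _ (glLin_injective h) _).finrank_eq,
          (p.flag i).2.2.2, (q.flag i).2.2.2]

lemma stable_of_mem_stabilizer {p : StarDatum F k m n β} {h : GL (Fin n) F}
    (hh : h ∈ MulAction.stabilizer (GL (Fin n) F) p) (i : Fin k) (j : ℕ) :
    ∀ w ∈ (p.flag i).1 j, glLin h w ∈ (p.flag i).1 j :=
  (smul_eq_iff.1 (MulAction.mem_stabilizer_iff.1 hh)).2 i j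

/-- The determinant of the action of the stabilizer of a datum on a step of a flag. -/
noncomputable def flagDet (p : StarDatum F k m n β) (i : Fin k) (j : ℕ) :
    MulAction.stabilizer (GL (Fin n) F) p →* Fˣ :=
  (LinearMap.det.comp
    { toFun := fun h => ((glLin h.1).restrict (stable_of_mem_stabilizer h.2 i j) :
        Module.End F ((p.flag i).1 j))
      map_one' := by
        refine LinearMap.ext fun w => Subtype.ext ?_
        change glLin 1 (w : Fin n → F) = w
        rw [glLin_one, LinearMap.id_apply]
      map_mul' := fun g h => by
        refine LinearMap.ext fun w => Subtype.ext ?_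
        change glLin (g.1 * h.1) (w : Fin n → F) = glLin g.1 (glLin h.1 w)
        rw [glLin_mul, LinearMap.comp_apply] }).toHomUnits

lemma flagDet_val (p : StarDatum F k m n β) (i : Fin k) (j : ℕ)
    (h : MulAction.stabilizer (GL (Fin n) F) p) :
    (flagDet p i j h : F) =
      LinearMap.det ((glLin h.1).restrict (stable_of_mem_stabilizer h.2 i j)) := rfl

lemma det_restrict_eq {M N : Type} [AddCommGroup M] [Module F M] [AddCommGroup N] [Module F N]
    {T : M →ₗ[F] M} {W : Submodule F M} (hW : ∀ w ∈ W, T w ∈ W) (φ : N →ₗ[F] M)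
    (hφ : Function.Injective φ) (hr : LinearMap.range φ = W) {t : N →ₗ[F] N}
    (ht : ∀ w, φ (t w) = T (φ w)) : LinearMap.det (T.restrict hW) = LinearMap.det t := by
  subst hr
  let e := LinearEquiv.ofInjective φ hφ
  rw [← LinearMap.det_conj t e]
  congr 1
  refine LinearMap.ext fun w => ?_
  obtain ⟨w, rfl⟩ := e.surjective w
  apply Subtype.ext
  simp [e, ht]

lemma flagDet_zero (p : StarDatum F k m n β) (i : Fin k)
    (h : MulAction.stabilizer (GL (Fin n) F) p) :
    flagDet p i 0 h = Matrix.GeneralLinearGroup.det h.1 := by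
  apply Units.ext
  rw [flagDet_val, det_restrict_eq _ LinearMap.id Function.injective_id _ (t := glLin h.1)
    (fun _ => rfl)]
  · exact LinearMap.det_toLin' _
  · rw [LinearMap.range_id, (p.flag i).2.1]

lemma flagDet_eq_one (p : StarDatum F k m n β) (i : Fin k) (j : ℕ) (hj : β i j = 0) :
    flagDet p i j = 1 := by
  refine MonoidHom.ext fun h => Units.ext ?_
  rw [flagDet_val]
  have h0 := ((p.flag i).2.2.2 j).trans hj
  exact LinearMap.det_eq_one_of_finrank_eq_zero h0 _

lemma flagDet_smul (g : GL (Fin n) F) (p : StarDatum F k m n β) (i : Fin k) (j : ℕ)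
    (h : MulAction.stabilizer (GL (Fin n) F) (g • p))
    (h' : MulAction.stabilizer (GL (Fin n) F) p) (hh : h.1 * g = g * h'.1) :
    flagDet (g • p) i j h = flagDet p i j h' := by
  apply Units.ext
  rw [flagDet_val, flagDet_val]
  refine det_restrict_eq _ ((glLin g).comp ((p.flag i).1 j).subtype)
    ((glLin_injective g).comp Subtype.val_injective) ?_ fun w => ?_
  · rw [LinearMap.range_comp, Submodule.range_subtype, smul_flag]
  · change glLin g (glLin h'.1 w) = glLin h.1 (glLin g w)
    rw [← LinearMap.comp_apply, ← LinearMap.comp_apply, ← glLin_mul, ← glLin_mul, hh]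

lemma det_restrict_eq_quotDet_mul {M : Type} [AddCommGroup M] [Module F M]
    [FiniteDimensional F M] {T : M →ₗ[F] M} {W U : Submodule F M} (hUW : U ≤ W)
    (h1 : ∀ w ∈ W, T w ∈ W) (h2 : ∀ w ∈ U, T w ∈ U) :
    LinearMap.det (T.restrict h1) = quotDet T W U * LinearMap.det (T.restrict h2) := by
  have hx : ∀ x ∈ U.comap W.subtype, (T.restrict h1) x ∈ U.comap W.subtype := fun x hx => by
    simpa only [Submodule.mem_comap, LinearMap.restrict_apply, Submodule.subtype_apply]
      using h2 x.1 hx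
  let K := U.comap W.subtype
  have h3 := LinearMap.det_eq_det_mul_det (V := W) K (T.restrict h1) hx
  rw [quotDet, dif_pos ⟨h1, h2⟩, h3, mul_comm]
  congr 1
  symm
  refine det_restrict_eq _ (W.subtype.comp K.subtype)
    (Subtype.val_injective.comp Subtype.val_injective) ?_ fun w => rfl
  rw [LinearMap.range_comp, Submodule.range_subtype, Submodule.map_comap_subtype, inf_eq_right]
  exact hUW

lemma quotDet_mul_flagDet (p : StarDatum F k m n β) (i : Fin k) (j : ℕ)
    (h : MulAction.stabilizer (GL (Fin n) F) p) :
    quotDet (glLin h.1) ((p.flag i).1 j) ((p.flag i).1 (j + 1)) * flagDet p i (j + 1) h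
      = flagDet p i j h :=
  (det_restrict_eq_quotDet_mul ((p.flag i).2.2.1 j) (stable_of_mem_stabilizer h.2 i j)
    (stable_of_mem_stabilizer h.2 i (j + 1))).symm

lemma χap_quotDet (χ : Fˣ →* ℂˣ) (p : StarDatum F k m n β) (i : Fin k) (j : ℕ)
    (h : MulAction.stabilizer (GL (Fin n) F) p) :
    χap χ (quotDet (glLin h.1) ((p.flag i).1 j) ((p.flag i).1 (j + 1)))
      = ((χ (flagDet p i j h) * (χ (flagDet p i (j + 1) h))⁻¹ : ℂˣ) : ℂ) := by
  have h1 := quotDet_mul_flagDet p i j h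
  have hne : quotDet (glLin h.1) ((p.flag i).1 j) ((p.flag i).1 (j + 1)) ≠ 0 := by
    intro h0
    rw [h0, zero_mul] at h1
    exact (flagDet p i j h).ne_zero h1.symm
  rw [χap, dif_neg hne, ← map_inv, ← map_mul]
  congr 2
  rw [eq_mul_inv_iff_mul_eq]
  exact Units.ext h1

lemma prod_range_telescope {G H : Type} [CommGroup G] [CommGroup H] (γ : ℕ → (G →* H)) (D : ℕ → G)
    (l : ℕ) :
    (∏ j ∈ Finset.range (l + 1), γ j (D j) * (γ j (D (j + 1)))⁻¹) * γ l (D (l + 1))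
      = γ 0 (D 0) * ∏ j ∈ Finset.range l, (γ (j + 1) * (γ j)⁻¹) (D (j + 1)) := by
  induction l with
  | zero => simp
  | succ l ih =>
    rw [Finset.prod_range_succ _ l, ← mul_assoc, ← ih, Finset.prod_range_succ _ (l + 1)]
    simp only [MonoidHom.mul_apply, MonoidHom.inv_apply]
    have h : ∀ P a b c : H, P * (a * b⁻¹) * b = P * c * (a * c⁻¹) := by
      intro P a b c
      rw [mul_assoc, inv_mul_cancel_right, mul_assoc P c, mul_comm c, inv_mul_cancel_right]
    exact h _ _ _ _

/-- The character of the stabilizer of a datum given by a tuple of characters indexed by the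
vertices of the star-shaped quiver. -/
noncomputable def vertexDet {s : Fin k → ℕ} (p : StarDatum F k m n β) :
    StarV k s → (MulAction.stabilizer (GL (Fin n) F) p →* Fˣ)
  | none => Matrix.GeneralLinearGroup.det.comp (Subgroup.subtype _)
  | some a => flagDet p a.1 (a.2.1 + 1)

/-- The linear character of the stabilizer of a datum given by a tuple of characters indexed by
the vertices of the star-shaped quiver. -/
noncomputable def stabChar {s : Fin k → ℕ} (σ : StarV k s → (Fˣ →* ℂˣ))
    (p : StarDatum F k m n β) : MulAction.stabilizer (GL (Fin n) F) p →* ℂˣ :=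
  ∏ v, (σ v).comp (vertexDet p v)

lemma stabChar_apply {s : Fin k → ℕ} (σ : StarV k s → (Fˣ →* ℂˣ))
    (p : StarDatum F k m n β) (h : MulAction.stabilizer (GL (Fin n) F) p) :
    stabChar σ p h = ∏ v, σ v (vertexDet p v h) := by
  rw [stabChar, MonoidHom.finsetProd_apply]
  rfl

lemma vertexDet_smul {s : Fin k → ℕ} (g : GL (Fin n) F) (p : StarDatum F k m n β) (v : StarV k s)
    (h : MulAction.stabilizer (GL (Fin n) F) (g • p))
    (h' : MulAction.stabilizer (GL (Fin n) F) p) (hh : h.1 * g = g * h'.1) :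
    vertexDet (g • p) v h = vertexDet p v h' := by
  rcases v with _ | a
  · have h1 := congrArg Matrix.GeneralLinearGroup.det hh
    rw [map_mul, map_mul, mul_comm] at h1
    exact mul_left_cancel h1
  · exact flagDet_smul g p _ _ h h' hh

lemma prod_χap_quotDet {s : Fin k → ℕ} (γ : Fin k → ℕ → (Fˣ →* ℂˣ))
    (hβ : ∀ i, β i (s i + 1) = 0)
    (p : StarDatum F k m n β) (h : MulAction.stabilizer (GL (Fin n) F) p) :
    ∏ i, ∏ j ∈ Finset.range (s i + 1),
      χap (γ i j) (quotDet (glLin h.1) ((p.flag i).1 j) ((p.flag i).1 (j + 1)))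
    = (stabChar (starσ F k s γ) p h : ℂ) := by
  simp only [χap_quotDet]
  rw [stabChar_apply, Fintype.prod_option, Fintype.prod_sigma]
  simp only [← Units.coe_prod]
  congr 1
  have h0 : starσ F k s γ none (vertexDet (s := s) p none h)
      = ∏ i, γ i 0 (flagDet p i 0 h) := by
    simp only [flagDet_zero]
    rw [starσ, MonoidHom.finsetProd_apply]
    rfl
  rw [h0, ← Finset.prod_mul_distrib]
  refine Finset.prod_congr rfl fun i _ => ?_
  have h1 := prod_range_telescope (γ i) (fun j => flagDet p i j h) (s i)
  simp only [flagDet_eq_one p i _ (hβ i), MonoidHom.one_apply, map_one, mul_one] at h1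
  rw [h1, ← Fin.prod_univ_eq_prod_range]
  rfl

end QRep

namespace QRep

variable {F : Type} [Field F]

lemma exists_mulVec_lift {M : Type} [AddCommGroup M] [Module F M] {p q : ℕ}
    (φ : (Fin p → F) →ₗ[F] M) (ψ : (Fin q → F) →ₗ[F] M)
    (h : ∀ w, ψ w ∈ LinearMap.range φ) :
    ∃ A : Matrix (Fin p) (Fin q) F, ∀ w, φ (A *ᵥ w) = ψ w := by
  choose c hc using fun i => h (Pi.single i 1)
  refine ⟨(Matrix.of c)ᵀ, fun w => ?_⟩
  have : φ.comp (Matrix.mulVecLin (Matrix.of c)ᵀ) = ψ := by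
    refine LinearMap.pi_ext' fun i => LinearMap.ext_ring ?_
    simp only [LinearMap.comp_apply, LinearMap.single_apply, Matrix.mulVecLin_apply,
      Matrix.mulVec_single_one]
    exact hc i
  exact LinearMap.congr_fun this w

variable {k m : ℕ} {s : Fin k → ℕ} {β : StarV k s → ℕ}

lemma starV_induction {P : StarV k s → Prop} (h0 : P none)
    (h1 : ∀ a, P (legPrev k s a) → P (some a)) (v : StarV k s) : P v := by
  rcases v with _ | ⟨i, ⟨j, hj⟩⟩
  · exact h0
  · induction j with
    | zero => exact h1 _ h0
    | succ j ih => exact h1 _ (ih (Nat.lt_of_succ_lt hj))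

lemma toRoot_mulVec {x y : Rep (starSrc k m s) (starTgt k m s) F β}
    {t : ∀ v, Matrix (Fin (β v)) (Fin (β v)) F}
    (ht : ∀ a w, t (legPrev k s a) *ᵥ legMap x a w = legMap y a (t (some a) *ᵥ w)) (v : StarV k s) :
    ∀ w, toRoot y v (t v *ᵥ w) = t none *ᵥ toRoot x v w := by
  induction v using starV_induction with
  | h0 => exact fun w => rfl
  | h1 a ih =>
    intro w
    rw [toRoot_some, toRoot_some, LinearMap.comp_apply, LinearMap.comp_apply, ← ht, ih]

lemma legMap_mulVec {x y : Rep (starSrc k m s) (starTgt k m s) F β}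
    (hy : ∀ v, Function.Injective (toRoot y v))
    {t : ∀ v, Matrix (Fin (β v)) (Fin (β v)) F}
    {h : (Fin (β none) → F) →ₗ[F] (Fin (β none) → F)}
    (ht : ∀ v w, toRoot y v (t v *ᵥ w) = h (toRoot x v w)) (a w) :
    t (legPrev k s a) *ᵥ legMap x a w = legMap y a (t (some a) *ᵥ w) := by
  have hs : ∀ (z : Rep (starSrc k m s) (starTgt k m s) F β) w,
      toRoot z (legPrev k s a) (legMap z a w) = toRoot z (some a) w := fun z w => by
    rw [toRoot_some, LinearMap.comp_apply]
  apply hy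
  rw [ht, hs, hs, ht]

lemma glAct_eq_iff {I Ω : Type} {src tgt : Ω → I} {β : I → ℕ} {g : ∀ i, GL (Fin (β i)) F}
    {x y : Rep src tgt F β} : glAct src tgt g x = y ↔ ∀ a,
      (g (tgt a) : Matrix (Fin (β (tgt a))) (Fin (β (tgt a))) F) * x a
        = y a * (g (src a) : Matrix (Fin (β (src a))) (Fin (β (src a))) F) := by
  constructor
  · rintro rfl a
    rw [glAct, Matrix.mul_assoc _ _ (g (src a) : Matrix (Fin (β (src a))) (Fin (β (src a))) F),
      ← Units.val_mul, inv_mul_cancel, Units.val_one, Matrix.mul_one]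
  · intro h
    funext a
    rw [glAct, h, Matrix.mul_assoc, ← Units.val_mul, mul_inv_cancel, Units.val_one, Matrix.mul_one]

lemma glAct_star_eq_iff {g : ∀ v, GL (Fin (β v)) F}
    {x y : Rep (starSrc k m s) (starTgt k m s) F β} :
    glAct (starSrc k m s) (starTgt k m s) g x = y ↔
      (∀ r, (g none : Matrix (Fin (β none)) (Fin (β none)) F) * loopMat x r =
        loopMat y r * (g none : Matrix (Fin (β none)) (Fin (β none)) F)) ∧
      ∀ a w, glLin (g (legPrev k s a)) (legMap x a w) = legMap y a (glLin (g (some a)) w) := by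
  rw [glAct_eq_iff]
  refine ⟨fun h => ⟨fun r => h (.inl r), fun a w => ?_⟩, fun h => ?_⟩
  · exact (Matrix.mulVec_mulVec w _ _).trans
      ((congrArg (· *ᵥ w) (h (.inr a))).trans (Matrix.mulVec_mulVec w _ _).symm)
  · rintro (r | a)
    · exact h.1 r
    · apply matrix_ext_mulVec
      intro w
      rw [← Matrix.mulVec_mulVec, ← Matrix.mulVec_mulVec]
      exact h.2 a w

/-- The flag attached to a leg of a representation. -/
noncomputable def legFlag (x : Rep (starSrc k m s) (starTgt k m s) F β) (i : Fin k) :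
    ℕ → Submodule F (Fin (β none) → F)
  | 0 => ⊤
  | j + 1 => if hj : j < s i then LinearMap.range (toRoot x (some ⟨i, ⟨j, hj⟩⟩)) else ⊥

lemma legFlag_succ (x : Rep (starSrc k m s) (starTgt k m s) F β) (i : Fin k) (j : ℕ)
    (hj : j < s i) : legFlag x i (j + 1) = LinearMap.range (toRoot x (some ⟨i, ⟨j, hj⟩⟩)) :=
  dif_pos hj

lemma legFlag_succ_of_le (x : Rep (starSrc k m s) (starTgt k m s) F β) (i : Fin k) (j : ℕ)
    (hj : s i ≤ j) : legFlag x i (j + 1) = ⊥ :=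
  dif_neg hj.not_gt

/-- The dimensions of the steps of the flags attached to representations of dimension `β`. -/
def LegDim (β : StarV k s → ℕ) (b : Fin k → ℕ → ℕ) : Prop :=
  (∀ i, b i 0 = β none) ∧ (∀ a : (i : Fin k) × Fin (s i), b a.1 (a.2.1 + 1) = β (some a)) ∧
    ∀ i j, s i < j → b i j = 0

variable {b : Fin k → ℕ → ℕ}

/-- The tuple of matrices and flags attached to a representation of the star-shaped quiver with
injective maps along the legs. -/
noncomputable def datum (hb : LegDim β b) (x : Rep (starSrc k m s) (starTgt k m s) F β)
    (hx : ∀ v, Function.Injective (toRoot x v)) : StarDatum F k m (β none) b where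
  mat := loopMat x
  flag i := ⟨legFlag x i, by
    refine ⟨rfl, fun j => ?_, fun j => ?_⟩
    · by_cases hj : j < s i
      · rw [legFlag_succ x i j hj]
        cases j with
        | zero => exact le_top
        | succ j =>
          rw [legFlag_succ x i j (Nat.lt_of_succ_lt hj), toRoot_some]
          exact LinearMap.range_comp_le_range _ _
      · rw [legFlag_succ_of_le x i j (not_lt.1 hj)]
        exact bot_le
    · cases j with
      | zero =>
        rw [hb.1]
        exact finrank_top F _ |>.trans (Module.finrank_fin_fun F)
      | succ j =>
        by_cases hj : j < s i
        · rw [legFlag_succ x i j hj, LinearMap.finrank_range_of_inj (hx _),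
            Module.finrank_fin_fun]
          exact (hb.2.1 ⟨i, ⟨j, hj⟩⟩).symm
        · rw [legFlag_succ_of_le x i j (not_lt.1 hj), finrank_bot, hb.2.2 i _ (by omega)]⟩

variable {hb : LegDim β b}

lemma smul_datum_eq_iff {x y : Rep (starSrc k m s) (starTgt k m s) F β}
    {hx : ∀ v, Function.Injective (toRoot x v)} {hy : ∀ v, Function.Injective (toRoot y v)}
    {h : GL (Fin (β none)) F} :
    h • datum hb x hx = datum hb y hy ↔
      (∀ r, (h : Matrix (Fin (β none)) (Fin (β none)) F) * loopMat x r =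
        loopMat y r * (h : Matrix (Fin (β none)) (Fin (β none)) F)) ∧
      ∀ v w, glLin h (toRoot x v w) ∈ LinearMap.range (toRoot y v) := by
  rw [smul_eq_iff]
  refine and_congr Iff.rfl ⟨fun H v w => ?_, fun H i j w hw => ?_⟩
  · rcases v with _ | ⟨i, ⟨j, hj⟩⟩
    · exact ⟨_, rfl⟩
    · have := H i (j + 1) (toRoot x (some ⟨i, ⟨j, hj⟩⟩) w)
      change _ ∈ legFlag x i (j + 1) → _ ∈ legFlag y i (j + 1) at this
      rw [legFlag_succ x i j hj, legFlag_succ y i j hj] at this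
      exact this ⟨w, rfl⟩
  · change _ ∈ legFlag x i j at hw
    change _ ∈ legFlag y i j
    cases j with
    | zero => trivial
    | succ j =>
      by_cases hj : j < s i
      · rw [legFlag_succ _ i j hj] at hw ⊢
        obtain ⟨w, rfl⟩ := hw
        exact H _ w
      · rw [legFlag_succ_of_le _ i j (not_lt.1 hj), Submodule.mem_bot] at hw ⊢
        rw [hw, map_zero]

/-- Isomorphic representations have equivalent data. -/
lemma smul_datum_of_glAct {x y : Rep (starSrc k m s) (starTgt k m s) F β}
    (hx : ∀ v, Function.Injective (toRoot x v)) (hy : ∀ v, Function.Injective (toRoot y v))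
    {g : ∀ v, GL (Fin (β v)) F} (hg : glAct (starSrc k m s) (starTgt k m s) g x = y) :
    g none • datum hb x hx = datum hb y hy := by
  rw [smul_datum_eq_iff]
  rw [glAct_star_eq_iff] at hg
  exact ⟨hg.1, fun v w => ⟨_,
    toRoot_mulVec (t := fun v => (g v : Matrix (Fin (β v)) (Fin (β v)) F)) hg.2 v w⟩⟩

/-- An equivalence of data lifts to an isomorphism of representations. -/
lemma exists_glAct_of_smul_datum {x y : Rep (starSrc k m s) (starTgt k m s) F β}
    {hx : ∀ v, Function.Injective (toRoot x v)} {hy : ∀ v, Function.Injective (toRoot y v)}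
    {h : GL (Fin (β none)) F} (H : h • datum hb x hx = datum hb y hy) :
    ∃ g : ∀ v, GL (Fin (β v)) F, glAct (starSrc k m s) (starTgt k m s) g x = y ∧
      ∀ v w, toRoot y v (glLin (g v) w) = glLin h (toRoot x v w) := by
  have H' : h⁻¹ • datum hb y hy = datum hb x hx := by rw [← H, inv_smul_smul]
  rw [smul_datum_eq_iff] at H H'
  choose t ht using fun v =>
    exists_mulVec_lift (toRoot y v) ((glLin h).comp (toRoot x v)) (H.2 v)
  choose t' ht' using fun v =>
    exists_mulVec_lift (toRoot x v) ((glLin h⁻¹).comp (toRoot y v)) (H'.2 v)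
  have h1 : ∀ v, t v * t' v = 1 := by
    intro v
    apply matrix_ext_mulVec
    intro w
    apply hy v
    rw [← Matrix.mulVec_mulVec, ht, LinearMap.comp_apply, ht', LinearMap.comp_apply,
      glLin_apply_inv, Matrix.one_mulVec]
  have h2 : ∀ v, t' v * t v = 1 := fun v => mul_eq_one_comm.1 (h1 v)
  have hnone : t none = (h : Matrix (Fin (β none)) (Fin (β none)) F) :=
    matrix_ext_mulVec fun w => ht none w
  refine ⟨fun v => ⟨t v, t' v, h1 v, h2 v⟩, ?_, ht⟩
  rw [glAct_star_eq_iff]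
  refine ⟨fun r => ?_, legMap_mulVec (h := glLin h) hy ht⟩
  change t none * _ = _ * t none
  rw [hnone]
  exact H.1 r

/-- Every datum comes from a representation. -/
lemma exists_datum_eq (hb : LegDim β b) (p : StarDatum F k m (β none) b) :
    ∃ (x : Rep (starSrc k m s) (starTgt k m s) F β) (hx : ∀ v, Function.Injective (toRoot x v)),
      datum hb x hx = p := by
  have hex : ∀ v : StarV k s, ∃ φ : (Fin (β v) → F) →ₗ[F] (Fin (β none) → F),
      Function.Injective φ ∧ match v with
        | none => ∀ w, HEq (φ w) w
        | some a => LinearMap.range φ = (p.flag a.1).1 (a.2.1 + 1) := by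
    rintro (_ | a)
    · exact ⟨LinearMap.id, Function.injective_id, fun w => HEq.rfl⟩
    · let e : (Fin (β (some a)) → F) ≃ₗ[F] (p.flag a.1).1 (a.2.1 + 1) :=
        LinearEquiv.ofFinrankEq _ _ (by
          rw [Module.finrank_fin_fun, (p.flag a.1).2.2.2, hb.2.1])
      refine ⟨((p.flag a.1).1 (a.2.1 + 1)).subtype.comp e.toLinearMap,
        Subtype.val_injective.comp e.injective, ?_⟩
      change LinearMap.range _ = _
      rw [LinearMap.range_comp, LinearEquiv.range, Submodule.map_top, Submodule.range_subtype]
  choose φ hφ hr using hex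
  have hr0 : φ none = LinearMap.id := LinearMap.ext fun w => eq_of_heq (hr none w)
  have hrs : ∀ a, LinearMap.range (φ (some a)) = (p.flag a.1).1 (a.2.1 + 1) := fun a => hr (some a)
  have hle : ∀ a w, φ (some a) w ∈ LinearMap.range (φ (legPrev k s a)) := by
    rintro ⟨i, ⟨j, hj⟩⟩ w
    cases j with
    | zero =>
      change _ ∈ LinearMap.range (φ none)
      rw [hr0, LinearMap.range_id]
      trivial
    | succ j =>
      change _ ∈ LinearMap.range (φ (some ⟨i, ⟨j, Nat.lt_of_succ_lt hj⟩⟩))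
      rw [hrs]
      apply (p.flag i).2.2.1
      rw [← hrs ⟨i, ⟨j + 1, hj⟩⟩]
      exact ⟨w, rfl⟩
  choose A hA using fun a => exists_mulVec_lift (φ (legPrev k s a)) (φ (some a)) (hle a)
  let x : Rep (starSrc k m s) (starTgt k m s) F β := fun a => match a with
    | .inl r => p.mat r
    | .inr a => A a
  have hx : ∀ v, toRoot x v = φ v := by
    intro v
    induction v using starV_induction with
    | h0 => exact hr0.symm
    | h1 a ih =>
      rw [toRoot_some, ih]
      exact LinearMap.ext (hA a)
  refine ⟨x, fun v => by rw [hx]; exact hφ v, ?_⟩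
  refine StarDatum.ext rfl (funext fun i => Subtype.ext (funext fun j => ?_))
  change legFlag x i j = _
  cases j with
  | zero => exact ((p.flag i).2.1).symm
  | succ j =>
    by_cases hj : j < s i
    · rw [legFlag_succ _ _ _ hj, hx, hrs]
    · rw [legFlag_succ_of_le _ _ _ (not_lt.1 hj)]
      exact (Submodule.finrank_eq_zero.1
        (((p.flag i).2.2.2 _).trans (hb.2.2 i _ (by omega)))).symm

lemma vertexDet_datum {x : Rep (starSrc k m s) (starTgt k m s) F β}
    {hx : ∀ v, Function.Injective (toRoot x v)}
    (h : MulAction.stabilizer (GL (Fin (β none)) F) (datum hb x hx))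
    {t : ∀ v, Matrix (Fin (β v)) (Fin (β v)) F}
    (ht : ∀ v w, toRoot x v (t v *ᵥ w) = glLin h.1 (toRoot x v w)) (v : StarV k s) :
    (vertexDet (datum hb x hx) v h : F) = (t v).det := by
  rcases v with _ | ⟨i, ⟨j, hj⟩⟩
  · have : t none = (h.1 : Matrix (Fin (β none)) (Fin (β none)) F) :=
      matrix_ext_mulVec fun w => ht none w
    rw [this]
    rfl
  · rw [← LinearMap.det_toLin']
    exact det_restrict_eq (stable_of_mem_stabilizer h.2 i (j + 1))
      (toRoot x (some ⟨i, ⟨j, hj⟩⟩)) (hx _) (legFlag_succ x i j hj).symm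
      (t := Matrix.toLin' (t (some ⟨i, ⟨j, hj⟩⟩))) (ht _)

/-- Under the genericity assumption, a representation is absolutely indecomposable if and only if
the linear character of the stabilizer of its datum is trivial. -/
lemma indec_baseChange_iff_stabChar {L : Type} [Field L] [IsAlgClosed L] [Algebra F L] [Fintype F]
    (h0 : β none ≠ 0) (σ : StarV k s → (Fˣ →* ℂˣ)) (hα : ∏ v, σ v ^ β v = 1)
    (hgen : ∀ δ : StarV k s → ℕ, NonIncr k s δ → δ ≠ 0 →
      (∀ v, δ v ≤ β v) → δ ≠ β → ∏ v, σ v ^ δ v ≠ 1)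
    (x : Rep (starSrc k m s) (starTgt k m s) F β) (hx : ∀ v, Function.Injective (toRoot x v)) :
    Indec (starSrc k m s) (starTgt k m s)
      (baseChange (starSrc k m s) (starTgt k m s) (algebraMap F L) x) ↔
    ∀ h, stabChar σ (datum hb x hx) h = 1 := by
  constructor
  · intro hind h
    obtain ⟨g, hg, hgh⟩ := exists_glAct_of_smul_datum (MulAction.mem_stabilizer_iff.1 h.2)
    obtain ⟨a, ha⟩ := exists_det_eq_pow_of_indec_baseChange (L := L) h0 x hind
      (fun v => (g v : Matrix (Fin (β v)) (Fin (β v)) F)) (glAct_eq_iff.1 hg)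
    have hd := fun v => vertexDet_datum h hgh v
    have ha0 : a ≠ 0 := by
      rintro rfl
      have := (hd none).trans (ha none)
      rw [zero_pow h0] at this
      exact Units.ne_zero _ this
    have hu : ∀ v, vertexDet (datum hb x hx) v h = Units.mk0 a ha0 ^ β v := by
      intro v
      apply Units.ext
      rw [hd, ha, Units.val_pow_eq_pow_val, Units.val_mk0]
    have h1 := DFunLike.congr_fun hα (Units.mk0 a ha0)
    rw [MonoidHom.finsetProd_apply] at h1
    rw [stabChar_apply]
    simp only [hu, map_pow]
    exact h1
  · intro hσ
    refine indec_baseChange_of_det h0 x hx σ hgen fun t ht d hd => ?_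
    have hu : ∀ v, IsUnit (t v) := fun v => by
      rw [Matrix.isUnit_iff_isUnit_det, hd]
      exact (d v).isUnit
    have ht' := toRoot_mulVec (mem_endAlg_star.1 ht).2
    have hh : (hu none).unit • datum hb x hx = datum hb x hx :=
      smul_datum_eq_iff.2 ⟨(mem_endAlg_star.1 ht).1, fun v w => ⟨_, ht' v w⟩⟩
    rw [← hσ ⟨_, MulAction.mem_stabilizer_iff.2 hh⟩, stabChar_apply]
    refine Finset.prod_congr rfl fun v _ => congrArg _ (Units.ext ?_)
    rw [← hd]
    exact (vertexDet_datum _ ht' v).symm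

end QRep

namespace QRep

lemma sum_stabilizer_char {G X : Type} [Group G] [Fintype G] [MulAction G X] [Fintype X]
    [DecidableEq X] (c : ∀ p : X, MulAction.stabilizer G p →* ℂˣ) (Y : SubMulAction G X)
    (hY : ∀ p, p ∈ Y ↔ ∀ h, c p h = 1) :
    (∑ g : G, ∑ p : X, if hg : g • p = p then (c p ⟨g, hg⟩ : ℂ) else 0)
      = Nat.card (MulAction.orbitRel.Quotient G Y) * Nat.card G := by
  classical
  have key : ∀ p : X, (∑ g : G, if hg : g • p = p then (c p ⟨g, hg⟩ : ℂ) else 0)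
      = if p ∈ Y then ∑ g : G, (if g • p = p then 1 else 0 : ℂ) else 0 := by
    intro p
    split_ifs with hp
    · refine Finset.sum_congr rfl fun g _ => ?_
      split_ifs with hg
      · rw [(hY p).1 hp, Units.val_one]
      · rfl
    · have h1 : (Units.coeHom ℂ).comp (c p) ≠ 1 := fun h1 =>
        hp ((hY p).2 fun h => Units.ext (DFunLike.congr_fun h1 h))
      have h2 := sum_hom_units_eq_zero _ h1
      refine Eq.trans ?_ h2
      rw [← Finset.sum_filter_add_sum_filter_not Finset.univ (fun g : G => g • p = p),
        Finset.sum_eq_zero (s := Finset.univ.filter fun g : G => ¬ g • p = p)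
          (fun g hg => dif_neg (Finset.mem_filter.1 hg).2), add_zero]
      rw [Finset.sum_subtype _ (p := fun g => g ∈ MulAction.stabilizer G p)
        (fun g => by simp [MulAction.mem_stabilizer_iff])]
      exact Finset.sum_congr rfl fun g _ => dif_pos g.2
  have hB := MulAction.sum_card_fixedBy_eq_card_orbits_mul_card_group G Y
  rw [Nat.card_eq_fintype_card, Nat.card_eq_fintype_card, ← Nat.cast_mul]
  rw [← (show _ = Fintype.card (MulAction.orbitRel.Quotient G Y) * _ from hB), Nat.cast_sum,
    Finset.sum_comm]
  simp only [key]
  rw [← Finset.sum_filter, Finset.sum_comm]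
  refine Finset.sum_congr rfl fun g _ => ?_
  rw [Finset.sum_subtype _ (p := fun q => q ∈ Y) (fun q => by simp)]
  rw [Fintype.card_subtype, Finset.card_filter, Nat.cast_sum]
  refine Finset.sum_congr rfl fun y _ => ?_
  rw [Nat.cast_ite, Nat.cast_one, Nat.cast_zero]
  exact if_congr ⟨fun h => Subtype.ext h, fun h => congrArg Subtype.val h⟩ rfl rfl

variable {F : Type} [Field F] {k m n : ℕ} {b : Fin k → ℕ → ℕ}

open scoped Classical in
lemma HC_eq_sum (l : ℕ) (β : ℕ → ℕ) [Fintype (Flag F n β)] (γ : ℕ → (Fˣ →* ℂˣ))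
    (h : GL (Fin n) F) :
    HC F n l β γ h = ∑ V : Flag F n β, if ∀ j, ∀ w ∈ V.1 j, glLin h w ∈ V.1 j then
      ∏ j ∈ Finset.range (l + 1), χap (γ j) (quotDet (glLin h) (V.1 j) (V.1 (j + 1))) else 0 := by
  rw [← Finset.sum_filter, ← Finset.sum_coe_sort, ← finsum_eq_sum_of_fintype]
  let e : {V : ℕ → Submodule F (Fin n → F) //
      V 0 = ⊤ ∧ (∀ j, V (j + 1) ≤ V j) ∧ (∀ j, Module.finrank F (V j) = β j) ∧
      (∀ j, ∀ v ∈ V j, Matrix.mulVecLin (h : Matrix (Fin n) (Fin n) F) v ∈ V j)} ≃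
      (Finset.univ.filter fun V : Flag F n β => ∀ j, ∀ w ∈ V.1 j, glLin h w ∈ V.1 j) :=
    { toFun := fun V => ⟨⟨V.1, V.2.1, V.2.2.1, V.2.2.2.1⟩,
        Finset.mem_filter.2 ⟨Finset.mem_univ _, V.2.2.2.2⟩⟩
      invFun := fun V => ⟨V.1.1, V.1.2.1, V.1.2.2.1, V.1.2.2.2, (Finset.mem_filter.1 V.2).2⟩
      left_inv := fun _ => rfl
      right_inv := fun _ => rfl }
  exact finsum_eq_of_bijective e e.bijective fun _ => rfl

/-- A datum is a tuple of matrices together with a tuple of flags. -/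
def StarDatum.equivProd :
    StarDatum F k m n b ≃ (Fin m → Matrix (Fin n) (Fin n) F) × ∀ i, Flag F n (b i) where
  toFun p := (p.mat, p.flag)
  invFun p := ⟨p.1, p.2⟩
  left_inv _ := rfl
  right_inv _ := rfl

open scoped Classical in
lemma Λcount_mul_prod_HC [Finite F] [Fintype (StarDatum F k m n b)] {s : Fin k → ℕ}
    (hb : ∀ i j, s i < j → b i j = 0) (γ : Fin k → ℕ → (Fˣ →* ℂˣ)) (h : GL (Fin n) F) :
    (Λcount F n m h : ℂ) * ∏ i, HC F n (s i) (b i) (γ i) h =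
      ∑ p : StarDatum F k m n b, if hg : h • p = p then
        (stabChar (starσ F k s γ) p ⟨h, hg⟩ : ℂ) else 0 := by
  have := fun i => finite_flag F n (s i) (hb i)
  let _ := fun i => Fintype.ofFinite (Flag F n (b i))
  let _ := Fintype.ofFinite F
  simp only [HC_eq_sum]
  rw [Finset.prod_univ_sum, Fintype.piFinset_univ, Λcount, Nat.card_eq_fintype_card,
    Fintype.card_subtype, Finset.card_filter, Nat.cast_sum, Finset.sum_mul_sum,
    ← Fintype.sum_prod_type', ← StarDatum.equivProd.sum_comp]
  refine Finset.sum_congr rfl fun p _ => ?_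
  change ((if ∀ r, (h : Matrix (Fin n) (Fin n) F) * p.mat r =
      p.mat r * (h : Matrix (Fin n) (Fin n) F) then 1 else 0 : ℕ) : ℂ) *
    ∏ i, (if ∀ j, ∀ w ∈ (p.flag i).1 j, glLin h w ∈ (p.flag i).1 j then _ else 0) = _
  split_ifs with h1 h2
  · rw [Nat.cast_one, one_mul, ← prod_χap_quotDet γ (fun i => hb i _ (Nat.lt_succ_self _))]
    exact Finset.prod_congr rfl fun i _ => if_pos ((smul_eq_iff.1 h2).2 i)
  · rw [smul_eq_iff] at h2
    push Not at h2
    obtain ⟨i, j, w, hw⟩ := h2 h1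
    rw [Finset.prod_eq_zero (Finset.mem_univ i), mul_zero]
    exact if_neg fun h3 => hw.2 (h3 j w hw.1)
  · exact absurd (smul_eq_iff.1 ‹_›).1 h1
  · rw [Nat.cast_zero, zero_mul]

/-- The data on whose stabilizers the linear characters attached to `σ` are trivial. -/
def trivialData (m : ℕ) (b : Fin k → ℕ → ℕ) {s : Fin k → ℕ} (σ : StarV k s → (Fˣ →* ℂˣ)) :
    SubMulAction (GL (Fin n) F) (StarDatum F k m n b) where
  carrier := {p | ∀ h, stabChar σ p h = 1}
  smul_mem' := by
    intro g p hp h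
    have hstab : g⁻¹ * h.1 * g ∈ MulAction.stabilizer (GL (Fin n) F) p := by
      rw [MulAction.mem_stabilizer_iff, mul_smul, mul_smul, MulAction.mem_stabilizer_iff.1 h.2,
        inv_smul_smul]
    rw [← hp ⟨_, hstab⟩, stabChar_apply, stabChar_apply]
    refine Finset.prod_congr rfl fun v _ => congrArg _ (vertexDet_smul g p v h _ ?_)
    change h.1 * g = g * (g⁻¹ * h.1 * g)
    group

lemma mem_trivialData {s : Fin k → ℕ} {σ : StarV k s → (Fˣ →* ℂˣ)} {p : StarDatum F k m n b} :
    p ∈ trivialData m b σ ↔ ∀ h, stabChar σ p h = 1 := Iff.rfl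

lemma orbitCount_eq_card_orbits_trivialData [Fintype F] {s : Fin k → ℕ} {β : StarV k s → ℕ}
    (hb : LegDim β b) (h0 : β none ≠ 0) (σ : StarV k s → (Fˣ →* ℂˣ)) (hα : ∏ v, σ v ^ β v = 1)
    (hgen : ∀ δ : StarV k s → ℕ, NonIncr k s δ → δ ≠ 0 →
      (∀ v, δ v ≤ β v) → δ ≠ β → ∏ v, σ v ^ δ v ≠ 1) :
    orbitCount (starSrc k m s) (starTgt k m s) (K := F) β
        (fun x => Indec (starSrc k m s) (starTgt k m s)
          (baseChange (starSrc k m s) (starTgt k m s)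
            (algebraMap F (AlgebraicClosure F)) x))
      = Nat.card (MulAction.orbitRel.Quotient (GL (Fin (β none)) F)
          (trivialData (n := β none) m b σ)) := by
  have hinj : ∀ {x : Rep (starSrc k m s) (starTgt k m s) F β},
      Indec (starSrc k m s) (starTgt k m s) (baseChange (starSrc k m s) (starTgt k m s)
        (algebraMap F (AlgebraicClosure F)) x) → ∀ v, Function.Injective (toRoot x v) :=
    fun hx => toRoot_injective_of_indec_baseChange _ h0 _ hx
  have hiff := indec_baseChange_iff_stabChar (m := m) (hb := hb) (L := AlgebraicClosure F)
    h0 σ hα hgen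
  refine Nat.card_congr (Equiv.ofBijective (Quot.lift (fun x => Quotient.mk _
    (⟨datum hb x.1 (hinj x.2), (hiff _ _).1 x.2⟩ : trivialData m b σ)) ?_) ⟨?_, ?_⟩)
  · rintro x y ⟨g, hg⟩
    refine Quotient.sound ?_
    symm
    exact ⟨g none, Subtype.ext (smul_datum_of_glAct (hb := hb) (hinj x.2) (hinj y.2) hg)⟩
  · rintro ⟨x⟩ ⟨y⟩ hxy
    obtain ⟨h, hh⟩ := Quotient.exact hxy
    obtain ⟨g, hg, -⟩ := exists_glAct_of_smul_datum (hb := hb) (hx := hinj y.2)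
      (hy := hinj x.2) (congrArg Subtype.val hh)
    exact (Quot.sound ⟨g, hg⟩).symm
  · rintro ⟨⟨p, hp⟩⟩
    obtain ⟨x, hx, rfl⟩ := exists_datum_eq hb p
    exact ⟨Quot.mk _ ⟨x, (hiff _ hx).2 hp⟩, rfl⟩

end QRep

open QRep in
/-- If `H*_{σ,α} = {α}` (i.e. `σ^α = 1` and `σ^δ ≠ 1` for every other
non-increasing `0 < δ ≤ α`), then the multiplicity equals the number of isomorphism
classes of absolutely indecomposable representations of `Q` of dimension `α` over
`𝔽_q`. -/
theorem statement8 (F : Type) [Field F] [Fintype F] (k m n : ℕ) (hk : 1 ≤ k) (hn : 1 ≤ n)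
    (s : Fin k → ℕ) (nn : Fin k → ℕ → ℕ) (hsum : ∀ i, legβ k s nn i 0 = n)
    (γ : Fin k → ℕ → (Fˣ →* ℂˣ))
    (hα : ∏ v, (starσ F k s γ v) ^ (starα k n s nn v) = 1)
    (hgen : ∀ δ : StarV k s → ℕ, NonIncr k s δ → δ ≠ 0 →
      (∀ v, δ v ≤ starα k n s nn v) → δ ≠ starα k n s nn →
      ∏ v, (starσ F k s γ v) ^ (δ v) ≠ 1) :
    mult F k m n s nn γ =
      (orbitCount (starSrc k m s) (starTgt k m s) (K := F) (starα k n s nn)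
        (fun x => Indec (starSrc k m s) (starTgt k m s)
          (baseChange (starSrc k m s) (starTgt k m s)
            (algebraMap F (AlgebraicClosure F)) x)) : ℂ) := by
  classical
  have hz : ∀ i j, s i < j → legβ k s nn i j = 0 := fun i j hj => by
    rw [legβ, Finset.Icc_eq_empty hj.not_ge, Finset.sum_empty]
  have hb : LegDim (starα k n s nn) (legβ k s nn) := ⟨hsum, fun _ => rfl, hz⟩
  have hfin := fun i => finite_flag F n (s i) (hz i)
  have : Finite (StarDatum F k m n (legβ k s nn)) := .of_equiv _ StarDatum.equivProd.symm
  let _ := Fintype.ofFinite (StarDatum F k m n (legβ k s nn))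
  rw [mult, finsum_eq_sum_of_fintype]
  simp only [Λcount_mul_prod_HC hz]
  rw [sum_stabilizer_char (fun p => stabChar (starσ F k s γ) p) (trivialData m _ (starσ F k s γ))
    fun _ => mem_trivialData, orbitCount_eq_card_orbits_trivialData hb (Nat.one_le_iff_ne_zero.1 hn)
    _ hα hgen, mul_comm, mul_assoc, mul_inv_cancel₀, mul_one]
  · rfl
  · exact_mod_cast Nat.card_pos.ne'
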